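/- arXiv:2507.03481 — 2 statements merged into one kernel-verified Lean document; each statement's English description precedes it below -/
import Mathlib

section
/- Let $\mathcal V,\mathcal X,\mathcal Y$ be finite alphabets, $P_V$ a probability distribution on $\mathcal V$, $W(y|x)$ a stochastic matrix from $\mathcal X$ to $\mathcal Y$, with product extensions $P^k$ and $W^n$. Logarithms are natural. A joint source-channel code with parameters $(k,n)$ is an encoder $f:\mathcal V^k\to\mathcal X^n$ together with a decoder $\varphi:\mathcal Y^n\to\mathcal V^k$; its error probability is $p_e=\sum_{v\in\mathcal V^k}P^k(v)\sum_{y:\varphi(y)\ne v}W^n(y|f(v))$. The type of a sequence is its empirical distribution; $\mathcal P_n(\mathcal X)$ is the set of types of sequences in $\mathcal X^n$, and $\mathcal T^n(Q)$ is the set of sequences of type $Q$. Let $$E_s(\rho,P_V)=(1+\rho)\log\sum_{v}P_V(v)^{\frac1{1+\rho}},\qquad d_B(x,\bar x)=-\log\sum_y\sqrt{W(y|x)W(y|\bar x)}\in[0,\infty],$$ $$E'_x(Q,\rho)=\min_{Q'}\Big(-\rho\sum_xQ(x)\log\sum_{\bar x}Q'(\bar x)e^{-d_B(x,\bar x)/\rho}\Big),$$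 where $Q'$ ranges over the probability distributions on $\mathcal X$, $e^{-\infty}=0$, $\log0=-\infty$, $0\cdot\infty=0$. Let $t>0$, $m\ge1$, and let $\mathcal Q_m=\{Q_1,\dots,Q_m\}$ be probability distributions on $\mathcal X$. Then the exponent $$E^{\mathrm{dual}}_{J,\mathrm{ex}}(t,\mathcal Q_m)=\sup_{\lambda\ge1}\big\{\bar E'_x(\mathcal Q_m,\lambda)-t\,E_s(\lambda,P_V)\big\}\in(-\infty,\infty],$$ $$\bar E'_x(\mathcal Q_m,\lambda)=\inf_{R\ge0}\ \sup_{\rho\ge1}\Big[\max_{Q\in\mathcal Q_m}E'_x(Q,\rho)+(\lambda-\rho)R\Big],$$ is achievable by partitioning the source sequences into $m$ classes with compositions approximating $Q_1,\dots,Q_m$. That is, for every real $E<E^{\mathrm{dual}}_{J,\mathrm{ex}}(t,\mathcal Q_m)$ and every $\delta>0$, for all sufficiently large $n$ and $k=\lfloor tn\rfloor$ there are a partition of $\mathcal V^k$ into (possibly empty) classes $\mathcal A_1,\dots,\mathcal A_m$, each a union of source type classes, compositions $\hat Q_1,\dots,\hat Q_m\in\mathcal P_n(\mathcal X)$ with $|\hat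 Q_c(x)-Q_c(x)|\le\delta$ for all $c,x$, and a joint source-channel code $(f,\varphi)$ with parameters $(k,n)$ such that $f(v)\in\mathcal T^n(\hat Q_c)$ for all $v\in\mathcal A_c$ and $$p_e\le e^{-nE}.$$ Moreover, if $t\log|\mathcal V|<\max_cH(Q_c)$, where $H$ is the Shannon entropy, then the partition can be chosen admissible, i.e. in addition $|\mathcal A_c|\le|\mathcal T^n(\hat Q_c)|$ for all $c$. -/
noncomputable section

/-- `P` is a probability distribution on the finite alphabet `α`. -/
def IsProbDist {α : Type*} [Fintype α] (P : α → ℝ) : Prop :=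
  (∀ a, 0 ≤ P a) ∧ ∑ a, P a = 1

/-- `W` is a discrete memoryless channel (a stochastic matrix), `W x y = W(y|x)`. -/
def IsDMC {X Y : Type*} [Fintype Y] (W : X → Y → ℝ) : Prop :=
  (∀ x y, 0 ≤ W x y) ∧ ∀ x, ∑ y, W x y = 1

/-- Product extension of a distribution: `P^k(v) = ∏ P(vᵢ)`. -/
def prodDist {α : Type*} (P : α → ℝ) {k : ℕ} (v : Fin k → α) : ℝ := ∏ i, P (v i)

/-- Product extension of a channel: `W^n(y|x) = ∏ W(y_l|x_l)`. -/
def Wn {X Y : Type*} (W : X → Y → ℝ) {n : ℕ} (x : Fin n → X) (y : Fin n → Y) : ℝ :=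
  ∏ l, W (x l) (y l)

/-- Shannon entropy (natural logarithm), with `0 log 0 = 0`. -/
def entH {α : Type*} [Fintype α] (P : α → ℝ) : ℝ := ∑ a, Real.negMulLog (P a)

open scoped Classical in
/-- Empirical distribution (type) of a sequence. -/
def empDist {α : Type*} {k : ℕ} (v : Fin k → α) : α → ℝ :=
  fun a => ((Finset.univ.filter fun i => v i = a).card : ℝ) / k

open scoped Classical in
/-- Type class `T^k(P)`: sequences of length `k` with empirical distribution `P`. -/
def typeClass {α : Type*} [Fintype α] (k : ℕ) (P : α → ℝ) : Finset (Fin k → α) :=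
  Finset.univ.filter fun v => empDist v = P

/-- `P` is a type of length-`k` sequences, i.e. `P ∈ 𝒫ₖ(α)`. -/
def IsType {α : Type*} (k : ℕ) (P : α → ℝ) : Prop :=
  ∃ v : Fin k → α, empDist v = P

open scoped Classical in
/-- Error probability of a joint source-channel code `(f, φ)`. -/
def pErr {V X Y : Type*} [Fintype V] [Fintype Y] (PV : V → ℝ)
    (W : X → Y → ℝ) {k n : ℕ}
    (f : (Fin k → V) → Fin n → X) (φ : (Fin n → Y) → Fin k → V) : ℝ :=
  ∑ v : Fin k → V, prodDist PV v *
    ∑ y ∈ Finset.univ.filter (fun y : Fin n → Y => φ y ≠ v), Wn W (f v) y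

/-- A partition of `𝒱^k` into `m` classes, each a union of source type classes, where
class `c` carries a composition `Qc c ∈ 𝒫ₙ(𝒳)`. The class of `v` is `cls v`. -/
def TypePartition {V X : Type*} (n : ℕ) {k m : ℕ}
    (cls : (Fin k → V) → Fin m) (Qc : Fin m → X → ℝ) : Prop :=
  (∀ v v' : Fin k → V, empDist v = empDist v' → cls v = cls v') ∧
  (∀ c, IsType n (Qc c))

open scoped Classical in
/-- An admissible partition: moreover the type class of the composition of each class is
at least as large as the class. -/
def AdmissiblePartition {V X : Type*} [Fintype V] [Fintype X] (n : ℕ) {k m : ℕ}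
    (cls : (Fin k → V) → Fin m) (Qc : Fin m → X → ℝ) : Prop :=
  TypePartition n cls Qc ∧
  ∀ c, (Finset.univ.filter fun v : Fin k → V => cls v = c).card ≤ (typeClass n (Qc c)).card

/-- Gallager source function `E_s(ρ, P_V)`. -/
def Es {α : Type*} [Fintype α] (PV : α → ℝ) (ρ : ℝ) : ℝ :=
  (1 + ρ) * Real.log (∑ v, PV v ^ (1 / (1 + ρ)))

/-- Bhattacharyya distance; it is `⊤` when the output distributions of `x` and `x'` have
disjoint supports. -/
def dB {X Y : Type*} [Fintype Y] (W : X → Y → ℝ) (x x' : X) : EReal :=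
  -ENNReal.log (ENNReal.ofReal (∑ y, Real.sqrt (W x y * W x' y)))

/-- Dual weak expurgated function `E'_x(Q, ρ)`, with `e^{-∞} = 0`, `log 0 = -∞` and
`0 · ∞ = 0`. -/
def Ex' {X Y : Type*} [Fintype X] [Fintype Y] (W : X → Y → ℝ) (Q : X → ℝ) (ρ : ℝ) : EReal :=
  ⨅ (Q' : X → ℝ) (_ : IsProbDist Q'),
    -(ρ : EReal) * ∑ x, (Q x : EReal) *
      ENNReal.log (∑ x', ENNReal.ofReal (Q' x') * EReal.exp (-(dB W x x' / (ρ : EReal))))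

/-- `Ē'_x(𝒬ₘ, λ) = inf_{R ≥ 0} sup_{ρ ≥ 1} [max_{Q ∈ 𝒬ₘ} E'_x(Q, ρ) + (λ - ρ)R]`. -/
def ExBar {X Y : Type*} [Fintype X] [Fintype Y] (W : X → Y → ℝ) {m : ℕ}
    (Qs : Fin m → X → ℝ) (lam : ℝ) : EReal :=
  ⨅ (R : ℝ) (_ : 0 ≤ R), ⨆ (ρ : ℝ) (_ : 1 ≤ ρ),
    (⨆ c, Ex' W (Qs c) ρ) + (((lam - ρ) * R : ℝ) : EReal)

/-- The dual exponent `E^dual_{J,ex}(t, 𝒬ₘ) = sup_{λ ≥ 1} {Ē'_x(𝒬ₘ, λ) - t E_s(λ, P_V)}`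
(possibly `⊤`). -/
def EJexDual {V X Y : Type*} [Fintype V] [Fintype X] [Fintype Y]
    (PV : V → ℝ) (W : X → Y → ℝ) (t : ℝ) {m : ℕ} (Qs : Fin m → X → ℝ) : EReal :=
  ⨆ (lam : ℝ) (_ : 1 ≤ lam), ExBar W Qs lam - ((t * Es PV lam : ℝ) : EReal)

end

open Filter Topology

noncomputable section

/-! ### Types and type classes -/

open scoped Classical in
/-- Number of occurrences of the letter `a` in the sequence `v`. -/
def letterCount {α : Type*} {n : ℕ} (v : Fin n → α) (a : α) : ℕ :=
  (Finset.univ.filter fun i => v i = a).card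

theorem empDist_apply {α : Type*} {n : ℕ} (v : Fin n → α) (a : α) :
    empDist v a = (letterCount v a : ℝ) / n := rfl

theorem mem_typeClass {α : Type*} [Fintype α] {n : ℕ} {P : α → ℝ} {v : Fin n → α} :
    v ∈ typeClass n P ↔ empDist v = P := by
  simp [typeClass]

theorem sum_letterCount {α : Type*} [Fintype α] {n : ℕ} (v : Fin n → α) :
    ∑ a, letterCount v a = n := by
  classical
  have := Finset.card_eq_sum_card_fiberwise (f := v) (s := Finset.univ) (t := Finset.univ)
    (by simp)
  simp only [Finset.card_univ, Fintype.card_fin] at this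
  refine Eq.trans (Finset.sum_congr rfl fun a _ => ?_) this.symm
  unfold letterCount
  congr

theorem letterCount_le {α : Type*} {n : ℕ} (v : Fin n → α) (a : α) :
    letterCount v a ≤ n := by
  classical
  unfold letterCount
  exact (Finset.card_le_univ _).trans (by simp)

theorem prod_comp_eq_prod_pow_letterCount {α M : Type*} [Fintype α] [CommMonoid M] {n : ℕ}
    (v : Fin n → α) (g : α → M) : ∏ i, g (v i) = ∏ a, g a ^ letterCount v a := by
  classical
  rw [← Finset.prod_fiberwise' (s := Finset.univ) (g := v) (f := g)]
  refine Finset.prod_congr rfl fun a _ => ?_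
  rw [Finset.prod_const]
  unfold letterCount
  congr!

theorem mul_empDist {α : Type*} {n : ℕ} (hn : 0 < n) (v : Fin n → α) (a : α) :
    (n : ℝ) * empDist v a = letterCount v a := by
  rw [empDist_apply]
  field_simp

theorem empDist_isProbDist {α : Type*} [Fintype α] {n : ℕ} (hn : 0 < n) (v : Fin n → α) :
    IsProbDist (empDist v) := by
  refine ⟨fun a => by rw [empDist_apply]; positivity, ?_⟩
  simp only [empDist_apply]
  rw [← Finset.sum_div, ← Nat.cast_sum, sum_letterCount]
  field_simp

theorem factorial_le_card_typeClass_mul {α : Type*} [Fintype α] {n : ℕ} (v : Fin n → α) :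
    n.factorial ≤ (∏ a, (letterCount v a).factorial) * (typeClass n (empDist v)).card := by
  classical
  have hst : Fintype.card {g : Equiv.Perm (Fin n) // v ∘ g = v}
      = ∏ a, (letterCount v a).factorial := by
    rw [DomMulAct.stabilizer_card]
    refine Finset.prod_congr rfl fun a _ => ?_
    rw [Fintype.card_subtype]
    unfold letterCount
    congr!
  have h := Finset.card_le_mul_card_image_of_maps_to
    (s := (Finset.univ : Finset (Equiv.Perm (Fin n)))) (t := typeClass n (empDist v))
    (f := fun σ : Equiv.Perm (Fin n) => v ∘ σ) ?_ (∏ a, (letterCount v a).factorial) ?_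
  · simpa [Finset.card_univ, Fintype.card_perm] using h
  · intro σ _
    rw [mem_typeClass]
    funext a
    rw [empDist_apply, empDist_apply]
    congr 2
    unfold letterCount
    refine Finset.card_bij (fun i _ => σ i) (by simp) (by simp) ?_
    intro b hb
    refine ⟨σ.symm b, ?_, by simp⟩
    simpa using hb
  · intro w _
    rcases (Finset.univ.filter fun σ : Equiv.Perm (Fin n) => v ∘ σ = w).eq_empty_or_nonempty with
      he | ⟨σ₀, hσ₀⟩
    · rw [he]; simp
    · rw [← hst, Fintype.card_subtype]
      simp only [Finset.mem_filter, Finset.mem_univ, true_and] at hσ₀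
      refine Finset.card_le_card_of_injOn (fun σ : Equiv.Perm (Fin n) => σ * σ₀⁻¹) ?_ ?_
      · intro σ hσ
        simp only [Finset.coe_filter, Finset.mem_univ, true_and, Set.mem_ofPred_eq] at hσ ⊢
        funext i
        have h1 := congrFun hσ (σ₀.symm i)
        have h2 := congrFun hσ₀ (σ₀.symm i)
        simp only [Function.comp_apply, Equiv.apply_symm_apply] at h1 h2
        simp [h1, h2]
      · intro σ _ τ _ h
        simpa using h

theorem factorial_le_exp_mul (n : ℕ) :
    (n.factorial : ℝ) ≤ Real.exp 1 * (n + 1) * ((n : ℝ) / Real.exp 1) ^ n := by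
  have key : ∀ n : ℕ, ((n + 1).factorial : ℝ) ≤
      Real.exp 1 * (n + 1) * (((n : ℝ) + 1) / Real.exp 1) ^ (n + 1) := by
    intro n
    induction n with
    | zero => simp
    | succ n ih =>
      have he := Real.exp_pos 1
      have h1 : Real.exp 1 ≤ (((n : ℝ) + 2) / (n + 1)) ^ (n + 2) := by
        have h2 : (1 : ℝ) / (n + 2) ≤ Real.log (((n : ℝ) + 2) / (n + 1)) := by
          have := Real.one_sub_inv_le_log_of_pos (x := ((n : ℝ) + 2) / (n + 1)) (by positivity)
          refine le_trans (le_of_eq ?_) this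
          field_simp
          ring
        have h3 : (1 : ℝ) ≤ ((n : ℝ) + 2) * Real.log (((n : ℝ) + 2) / (n + 1)) := by
          rw [div_le_iff₀ (by positivity)] at h2
          linarith
        calc Real.exp 1 ≤ Real.exp (((n + 2 : ℕ) : ℝ) * Real.log (((n : ℝ) + 2) / (n + 1))) :=
              Real.exp_le_exp.mpr (by push_cast; exact h3)
          _ = _ := by rw [Real.exp_nat_mul, Real.exp_log (by positivity)]
      rw [Nat.factorial_succ]
      push_cast
      have h4 : ((n : ℝ) + 1 + 1) * ((n + 1).factorial : ℝ) ≤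
          ((n : ℝ) + 1 + 1) * (Real.exp 1 * (n + 1) * (((n : ℝ) + 1) / Real.exp 1) ^ (n + 1)) := by
        gcongr
      refine h4.trans ?_
      have h5 : Real.exp 1 * ((n : ℝ) + 1 + 1) * (((n : ℝ) + 1 + 1) / Real.exp 1) ^ (n + 1 + 1)
          = ((n : ℝ) + 1 + 1) * (Real.exp 1 * (n + 1) * (((n : ℝ) + 1) / Real.exp 1) ^ (n + 1))
            * ((((n : ℝ) + 2) / (n + 1)) ^ (n + 2) / Real.exp 1) := by
        have : (n : ℝ) + 1 + 1 = n + 2 := by ring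
        rw [this, div_pow, div_pow, div_pow]
        field_simp
        ring
      rw [h5]
      refine le_mul_of_one_le_right (by positivity) ?_
      rwa [le_div_iff₀ he, one_mul]
  cases n with
  | zero => simp
  | succ n =>
    refine (key n).trans ?_
    push_cast
    gcongr
    linarith

theorem div_exp_pow_le_factorial (n : ℕ) : ((n : ℝ) / Real.exp 1) ^ n ≤ n.factorial := by
  have h := Real.pow_div_factorial_le_exp (n : ℝ) (by positivity) n
  rw [div_le_iff₀ (by positivity)] at h
  rw [div_pow, div_le_iff₀ (by positivity), ← Real.exp_nat_mul, mul_one]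
  linarith

/-- Polynomial factor lost when comparing a type class with its product distribution. -/
def typePoly (α : Type*) [Fintype α] (n : ℕ) : ℝ :=
  (Real.exp 1 * (n + 1)) ^ Fintype.card α

theorem one_le_typePoly (α : Type*) [Fintype α] (n : ℕ) : 1 ≤ typePoly α n := by
  refine one_le_pow₀ ?_
  have := Real.one_le_exp (zero_le_one (α := ℝ))
  have h : (1 : ℝ) ≤ n + 1 := by linarith [Nat.cast_nonneg (α := ℝ) n]
  nlinarith

/-- A type class is not exponentially unlikely under its own product distribution. -/
theorem one_le_typePoly_mul_card_mul_prodDist {α : Type*} [Fintype α] {n : ℕ} (hn : 0 < n)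
    (v : Fin n → α) :
    1 ≤ typePoly α n * (typeClass n (empDist v)).card * prodDist (empDist v) v := by
  have hnR : (0 : ℝ) < n := by exact_mod_cast hn
  have he := Real.exp_pos 1
  have hprod : prodDist (empDist v) v =
      (∏ a, ((letterCount v a : ℝ) / Real.exp 1) ^ letterCount v a) / ((n : ℝ) / Real.exp 1) ^ n := by
    unfold prodDist
    rw [prod_comp_eq_prod_pow_letterCount v (empDist v)]
    have : ((n : ℝ) / Real.exp 1) ^ n = ∏ a, ((n : ℝ) / Real.exp 1) ^ letterCount v a := by
      rw [Finset.prod_pow_eq_pow_sum, sum_letterCount]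
    rw [this, ← Finset.prod_div_distrib]
    refine Finset.prod_congr rfl fun a _ => ?_
    rw [← div_pow, empDist_apply]
    congr 1
    field_simp
  have h1 : (n.factorial : ℝ) ≤
      (∏ a, ((letterCount v a).factorial : ℝ)) * (typeClass n (empDist v)).card := by
    exact_mod_cast factorial_le_card_typeClass_mul v
  have h2 : ∏ a, ((letterCount v a).factorial : ℝ) ≤
      typePoly α n * ∏ a, ((letterCount v a : ℝ) / Real.exp 1) ^ letterCount v a := by
    have : typePoly α n = ∏ _a : α, (Real.exp 1 * ((n : ℝ) + 1)) := by
      simp [typePoly]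
    rw [this, ← Finset.prod_mul_distrib]
    refine Finset.prod_le_prod (fun a _ => by positivity) fun a _ => ?_
    refine (factorial_le_exp_mul _).trans ?_
    have : (letterCount v a : ℝ) ≤ n := by exact_mod_cast letterCount_le v a
    gcongr
  rw [hprod, ← mul_div_assoc, le_div_iff₀ (by positivity), one_mul]
  calc ((n : ℝ) / Real.exp 1) ^ n ≤ n.factorial := div_exp_pow_le_factorial n
    _ ≤ _ := h1
    _ ≤ _ := mul_le_mul_of_nonneg_right h2 (Nat.cast_nonneg _)
    _ = _ := by ring

theorem prodDist_empDist {α : Type*} [Fintype α] {n : ℕ} (hn : 0 < n) (v : Fin n → α) :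
    prodDist (empDist v) v = Real.exp (-(n * entH (empDist v))) := by
  unfold prodDist entH
  rw [prod_comp_eq_prod_pow_letterCount v (empDist v), Finset.mul_sum, ← Finset.sum_neg_distrib,
    Real.exp_sum]
  refine Finset.prod_congr rfl fun a _ => ?_
  have h0 : 0 ≤ empDist v a := (empDist_isProbDist hn v).1 a
  rcases h0.eq_or_lt with h | h
  · have : (letterCount v a : ℝ) = 0 := by rw [← mul_empDist hn, ← h, mul_zero]
    rw [← h, Nat.cast_eq_zero.mp this]
    simp
  · rw [← Real.exp_log h, ← Real.exp_nat_mul, Real.exp_log h, Real.negMulLog, ← mul_empDist hn]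
    congr 1
    ring

theorem exp_entH_le_card_typeClass {α : Type*} [Fintype α] {n : ℕ} (hn : 0 < n) {Q : α → ℝ}
    (hQ : IsType n Q) :
    Real.exp (n * entH Q) ≤ typePoly α n * (typeClass n Q).card := by
  obtain ⟨v, rfl⟩ := hQ
  have h := one_le_typePoly_mul_card_mul_prodDist hn v
  rw [prodDist_empDist hn, Real.exp_neg, ← div_eq_mul_inv, le_div_iff₀ (Real.exp_pos _),
    one_mul] at h
  exact h

/-- Size of the type class of a sequence. -/
def typeSize {α : Type*} [Fintype α] {k : ℕ} (v : Fin k → α) : ℕ :=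
  (typeClass k (empDist v)).card

theorem typeSize_pos {α : Type*} [Fintype α] {k : ℕ} (v : Fin k → α) : 0 < typeSize v :=
  Finset.card_pos.mpr ⟨v, mem_typeClass.mpr rfl⟩

/-- The number of types is polynomial in the block length. -/
theorem sum_inv_typeSize_le {α : Type*} [Fintype α] (k : ℕ) :
    ∑ v : Fin k → α, ((typeSize v : ℝ))⁻¹ ≤ ((k : ℝ) + 1) ^ Fintype.card α := by
  classical
  have h1 : ∑ v : Fin k → α, ((typeSize v : ℝ))⁻¹ =
      ((Finset.univ.image (empDist : (Fin k → α) → α → ℝ)).card : ℝ) := by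
    rw [← Finset.sum_fiberwise_of_maps_to (s := Finset.univ)
      (t := Finset.univ.image (empDist : (Fin k → α) → α → ℝ)) (g := empDist)
      (fun v _ => Finset.mem_image_of_mem _ (Finset.mem_univ v))]
    rw [Finset.card_eq_sum_ones, Nat.cast_sum]
    refine Finset.sum_congr rfl fun P hP => ?_
    obtain ⟨v, -, rfl⟩ := Finset.mem_image.mp hP
    have : ∀ w ∈ Finset.univ.filter (fun w : Fin k → α => empDist w = empDist v),
        ((typeSize w : ℝ))⁻¹ = (typeSize v : ℝ)⁻¹ := by
      intro w hw
      simp only [Finset.mem_filter, Finset.mem_univ, true_and] at hw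
      rw [typeSize, hw, typeSize]
    rw [Finset.sum_congr rfl this, Finset.sum_const, nsmul_eq_mul]
    have h3 : (Finset.univ.filter (fun w : Fin k → α => empDist w = empDist v)).card
        = typeSize v := by
      unfold typeSize typeClass
      congr!
    rw [h3]
    have := typeSize_pos v
    push_cast
    field_simp
  rw [h1]
  have h2 : (Finset.univ.image (empDist : (Fin k → α) → α → ℝ)).card ≤
      (Finset.univ : Finset (α → Fin (k + 1))).card := by
    refine Finset.card_le_card_of_surjOn
      (fun c : α → Fin (k + 1) => fun a => ((c a : ℕ) : ℝ) / k) ?_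
    intro P hP
    simp only [Finset.coe_image, Finset.coe_univ, Set.image_univ, Set.mem_range] at hP
    obtain ⟨v, rfl⟩ := hP
    refine ⟨fun a => ⟨letterCount v a, Nat.lt_succ_of_le (letterCount_le v a)⟩, by simp, ?_⟩
    funext a
    rfl
  have h3 : ((Finset.univ : Finset (α → Fin (k + 1))).card : ℝ) = ((k : ℝ) + 1) ^ Fintype.card α := by
    simp
  rw [← h3]
  exact_mod_cast h2

/-- A sequence with prescribed letter counts. -/
theorem exists_letterCount_eq {α : Type*} [Fintype α] {n : ℕ} (c : α → ℕ) (hc : ∑ a, c a = n) :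
    ∃ v : Fin n → α, ∀ a, letterCount v a = c a := by
  classical
  have hcard : Fintype.card (Σ a, Fin (c a)) = n := by simp [hc]
  let e := Fintype.equivFinOfCardEq hcard
  refine ⟨fun i => (e.symm i).1, fun a => ?_⟩
  unfold letterCount
  have : (Finset.univ.filter fun i => (e.symm i).1 = a).card
      = (Finset.univ : Finset (Fin (c a))).card := by
    symm
    refine Finset.card_bij (fun j _ => e ⟨a, j⟩) (by simp) ?_ ?_
    · intro j _ j' _ h
      simpa using h
    · intro i hi
      simp only [Finset.mem_filter, Finset.mem_univ, true_and] at hi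
      subst hi
      exact ⟨(e.symm i).2, by simp, by simp⟩
  simpa using this

/-- Every distribution is approximated by types that, eventually, lose at most an arbitrarily
small fraction of the mass of each letter. -/
theorem exists_type_approx {α : Type*} [Fintype α] {Q : α → ℝ} (hQ : IsProbDist Q) :
    ∃ Qh : ℕ → α → ℝ, (∀ n, 0 < n → IsType n (Qh n)) ∧ Tendsto Qh atTop (𝓝 Q) ∧
      ∀ ε > 0, ∀ᶠ n in atTop, ∀ x, (1 - ε) * Q x ≤ Qh n x := by
  classical
  have hne : Nonempty α := by
    by_contra h
    rw [not_nonempty_iff] at h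
    have := hQ.2
    simp at this
  obtain ⟨x₀⟩ := hne
  have hex : ∀ n : ℕ, ∃ P : α → ℝ, 0 < n → IsType n P ∧
      ∀ x, Q x - 1 / n ≤ P x ∧ P x ≤ Q x + Fintype.card α / n := by
    intro n
    by_cases hn : 0 < n
    swap
    · exact ⟨Q, fun h => absurd h hn⟩
    have hnR : (0 : ℝ) < n := by exact_mod_cast hn
    let r : ℕ := ∑ x ∈ Finset.univ.erase x₀, ⌊n * Q x⌋₊
    have hfl : ∀ x, (⌊n * Q x⌋₊ : ℝ) ≤ n * Q x := fun x =>
      Nat.floor_le (mul_nonneg hnR.le (hQ.1 x))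
    have hfl' : ∀ x, (n : ℝ) * Q x - 1 ≤ ⌊n * Q x⌋₊ := fun x => (Nat.sub_one_lt_floor _).le
    have hsum : ∑ x ∈ Finset.univ.erase x₀, (n : ℝ) * Q x = n - n * Q x₀ := by
      have := Finset.add_sum_erase Finset.univ (fun x => (n : ℝ) * Q x) (Finset.mem_univ x₀)
      rw [← Finset.mul_sum (s := Finset.univ), hQ.2] at this
      linarith
    have hr : (r : ℝ) ≤ n - n * Q x₀ := by
      rw [← hsum]
      simp only [r, Nat.cast_sum]
      exact Finset.sum_le_sum fun x _ => hfl x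
    have hr' : (n : ℝ) - n * Q x₀ - Fintype.card α ≤ r := by
      rw [← hsum]
      simp only [r, Nat.cast_sum]
      have h1 : ∑ x ∈ Finset.univ.erase x₀, ((n : ℝ) * Q x - 1) ≤
          ∑ x ∈ Finset.univ.erase x₀, (⌊n * Q x⌋₊ : ℝ) := Finset.sum_le_sum fun x _ => hfl' x
      rw [Finset.sum_sub_distrib, Finset.sum_const, nsmul_eq_mul, mul_one] at h1
      have h2 : ((Finset.univ.erase x₀).card : ℝ) ≤ Fintype.card α := by
        exact_mod_cast Finset.card_le_univ _
      linarith
    have hrn : r ≤ n := by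
      have : (r : ℝ) ≤ n := hr.trans (by nlinarith [hQ.1 x₀])
      exact_mod_cast this
    let c : α → ℕ := fun x => if x = x₀ then n - r else ⌊n * Q x⌋₊
    have hc : ∑ x, c x = n := by
      rw [← Finset.add_sum_erase _ _ (Finset.mem_univ x₀)]
      have : ∑ x ∈ Finset.univ.erase x₀, c x = r := by
        refine Finset.sum_congr rfl fun x hx => ?_
        simp [c, Finset.ne_of_mem_erase hx]
      rw [this]
      simp only [c, if_true]
      omega
    obtain ⟨v, hv⟩ := exists_letterCount_eq c hc
    have hcard : (1 : ℝ) ≤ Fintype.card α := by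
      exact_mod_cast Fintype.card_pos_iff.mpr ⟨x₀⟩
    refine ⟨empDist v, fun _ => ⟨⟨v, rfl⟩, fun x => ?_⟩⟩
    have hb : (n : ℝ) * Q x - 1 ≤ c x ∧ (c x : ℝ) ≤ n * Q x + Fintype.card α := by
      by_cases hx : x = x₀
      · subst hx
        simp only [c, if_true, Nat.cast_sub hrn]
        constructor <;> linarith
      · simp only [c, if_neg hx]
        exact ⟨hfl' x, by linarith [hfl x]⟩
    rw [empDist_apply, hv]
    constructor
    · rw [le_div_iff₀ hnR, sub_mul, one_div, inv_mul_cancel₀ hnR.ne']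
      linarith [hb.1]
    · rw [div_le_iff₀ hnR, add_mul, div_mul_cancel₀ _ hnR.ne']
      linarith [hb.2]
  choose Qh hQh using hex
  refine ⟨Qh, fun n hn => (hQh n hn).1, ?_, ?_⟩
  · rw [tendsto_pi_nhds]
    intro x
    have h1 : Tendsto (fun n : ℕ => Q x - 1 / (n : ℝ)) atTop (𝓝 (Q x)) := by
      simpa using tendsto_const_nhds.sub (tendsto_const_div_atTop_nhds_zero_nat (1 : ℝ))
    have h2 : Tendsto (fun n : ℕ => Q x + (Fintype.card α : ℝ) / (n : ℝ)) atTop (𝓝 (Q x)) := by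
      simpa using tendsto_const_nhds.add
        (tendsto_const_div_atTop_nhds_zero_nat (Fintype.card α : ℝ))
    refine tendsto_of_tendsto_of_tendsto_of_le_of_le' h1 h2 ?_ ?_
    · filter_upwards [eventually_gt_atTop 0] with n hn using ((hQh n hn).2 x).1
    · filter_upwards [eventually_gt_atTop 0] with n hn using ((hQh n hn).2 x).2
  · intro ε hε
    rw [eventually_all]
    intro x
    rcases (hQ.1 x).eq_or_lt with h | h
    · filter_upwards [eventually_gt_atTop 0] with n hn
      obtain ⟨v, hv⟩ := (hQh n hn).1
      rw [← h, mul_zero, ← hv]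
      exact (empDist_isProbDist hn v).1 x
    · have h1 : ∀ᶠ n : ℕ in atTop, 1 / (n : ℝ) < ε * Q x :=
        (tendsto_const_div_atTop_nhds_zero_nat (1 : ℝ)).eventually_lt_const (mul_pos hε h)
      filter_upwards [eventually_gt_atTop 0, h1] with n hn h2
      have := ((hQh n hn).2 x).1
      nlinarith

theorem continuous_entH {α : Type*} [Fintype α] : Continuous (entH : (α → ℝ) → ℝ) := by
  unfold entH
  exact continuous_finsetSum _ fun a _ => Real.continuous_negMulLog.comp (continuous_apply a)

/-! ### The Bhattacharyya kernel and the weak expurgated function -/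

/-- Bhattacharyya coefficient of two channel inputs. -/
def bhat {X Y : Type*} [Fintype Y] (W : X → Y → ℝ) (x x' : X) : ℝ :=
  ∑ y, Real.sqrt (W x y * W x' y)

theorem bhat_nonneg {X Y : Type*} [Fintype Y] (W : X → Y → ℝ) (x x' : X) : 0 ≤ bhat W x x' :=
  Finset.sum_nonneg fun _ _ => Real.sqrt_nonneg _

theorem bhat_self {X Y : Type*} [Fintype Y] {W : X → Y → ℝ} (hW : IsDMC W) (x : X) :
    bhat W x x = 1 := by
  unfold bhat
  rw [← hW.2 x]
  exact Finset.sum_congr rfl fun y _ => Real.sqrt_mul_self (hW.1 x y)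

theorem bhat_comm {X Y : Type*} [Fintype Y] (W : X → Y → ℝ) (x x' : X) :
    bhat W x x' = bhat W x' x := by
  unfold bhat
  simp only [mul_comm]

theorem bhat_le_one {X Y : Type*} [Fintype Y] {W : X → Y → ℝ} (hW : IsDMC W) (x x' : X) :
    bhat W x x' ≤ 1 := by
  have h : ∀ y, Real.sqrt (W x y * W x' y) ≤ (W x y + W x' y) / 2 := fun y => by
    rw [Real.sqrt_le_left (by linarith [hW.1 x y, hW.1 x' y])]
    nlinarith [sq_nonneg (W x y - W x' y)]
  calc bhat W x x' ≤ ∑ y, (W x y + W x' y) / 2 := Finset.sum_le_sum fun y _ => h y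
    _ = 1 := by rw [← Finset.sum_div, Finset.sum_add_distrib, hW.2, hW.2]; norm_num

theorem exp_neg_dB_div {X Y : Type*} [Fintype Y] (W : X → Y → ℝ) (x x' : X) {ρ : ℝ}
    (hρ : 0 < ρ) :
    EReal.exp (-(dB W x x' / (ρ : EReal))) = ENNReal.ofReal (bhat W x x' ^ (1 / ρ)) := by
  have h : -(dB W x x' / (ρ : EReal)) =
      ((1 / ρ : ℝ) : EReal) * ENNReal.log (ENNReal.ofReal (bhat W x x')) := by
    unfold dB
    rw [EReal.div_eq_inv_mul, mul_comm, EReal.neg_mul, neg_neg, mul_comm, one_div, EReal.coe_inv]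
    rfl
  rw [h, ← ENNReal.rpow_eq_exp_mul_log,
    ENNReal.ofReal_rpow_of_nonneg (bhat_nonneg _ _ _) (by positivity)]

/-- Output of the tilted Bhattacharyya kernel averaged over the second input. -/
def tiltedBhat {X Y : Type*} [Fintype X] [Fintype Y] (W : X → Y → ℝ) (Q' : X → ℝ) (ρ : ℝ)
    (x : X) : ℝ :=
  ∑ x', Q' x' * bhat W x x' ^ (1 / ρ)

theorem tiltedBhat_nonneg {X Y : Type*} [Fintype X] [Fintype Y] (W : X → Y → ℝ) {Q' : X → ℝ}
    (hQ' : IsProbDist Q') (ρ : ℝ) (x : X) : 0 ≤ tiltedBhat W Q' ρ x :=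
  Finset.sum_nonneg fun x' _ => mul_nonneg (hQ'.1 x') (Real.rpow_nonneg (bhat_nonneg _ _ _) _)

theorem tiltedBhat_le_one {X Y : Type*} [Fintype X] [Fintype Y] {W : X → Y → ℝ} (hW : IsDMC W)
    {Q' : X → ℝ} (hQ' : IsProbDist Q') {ρ : ℝ} (hρ : 0 < ρ) (x : X) :
    tiltedBhat W Q' ρ x ≤ 1 := by
  rw [← hQ'.2]
  refine Finset.sum_le_sum fun x' _ => mul_le_of_le_one_right (hQ'.1 x') ?_
  exact Real.rpow_le_one (bhat_nonneg _ _ _) (bhat_le_one hW _ _) (by positivity)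

theorem EReal.coe_finset_sum_real {ι : Type*} (A : Finset ι) (g : ι → ℝ) :
    ((∑ i ∈ A, g i : ℝ) : EReal) = ∑ i ∈ A, (g i : EReal) := by
  classical
  induction A using Finset.induction_on with
  | empty => simp
  | insert i A hi ih => rw [Finset.sum_insert hi, Finset.sum_insert hi, EReal.coe_add, ih]

/-- Multiplicative form of the inequality `s ≤ E'_x(Q, ρ)`. -/
def ExpurgatedBound {X Y : Type*} [Fintype X] [Fintype Y] (W : X → Y → ℝ) (Q : X → ℝ)
    (ρ s : ℝ) : Prop :=
  ∀ Q' : X → ℝ, IsProbDist Q' → ∏ x, tiltedBhat W Q' ρ x ^ Q x ≤ Real.exp (-(s / ρ))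

theorem expurgatedBound_of_le_Ex' {X Y : Type*} [Fintype X] [Fintype Y] (W : X → Y → ℝ)
    {Q : X → ℝ} {ρ s : ℝ} (hρ : 0 < ρ) (hs : (s : EReal) ≤ Ex' W Q ρ) :
    ExpurgatedBound W Q ρ s := by
  intro Q' hQ'
  have h1 := hs.trans (iInf₂_le Q' hQ')
  have h2 : ∀ x, ∑ x', ENNReal.ofReal (Q' x') * EReal.exp (-(dB W x x' / (ρ : EReal))) =
      ENNReal.ofReal (tiltedBhat W Q' ρ x) := by
    intro x
    unfold tiltedBhat
    rw [ENNReal.ofReal_sum_of_nonneg fun x' _ =>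
      mul_nonneg (hQ'.1 x') (Real.rpow_nonneg (bhat_nonneg _ _ _) _)]
    refine Finset.sum_congr rfl fun x' _ => ?_
    rw [exp_neg_dB_div W x x' hρ, ENNReal.ofReal_mul (hQ'.1 x')]
  simp only [h2] at h1
  by_cases hz : ∃ x, tiltedBhat W Q' ρ x = 0 ∧ Q x ≠ 0
  · obtain ⟨x, hx, hq⟩ := hz
    rw [Finset.prod_eq_zero (Finset.mem_univ x) (by rw [hx, Real.zero_rpow hq])]
    positivity
  · push Not at hz
    have h3 : ∀ x, (Q x : EReal) * ENNReal.log (ENNReal.ofReal (tiltedBhat W Q' ρ x)) =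
        ((Q x * Real.log (tiltedBhat W Q' ρ x) : ℝ) : EReal) := by
      intro x
      by_cases hx : Q x = 0
      · simp [hx]
      · have : 0 < tiltedBhat W Q' ρ x :=
          lt_of_le_of_ne (tiltedBhat_nonneg W hQ' ρ x) fun h => hx (hz x h.symm)
        rw [ENNReal.log_ofReal_of_pos this, EReal.coe_mul]
    simp only [h3] at h1
    rw [← EReal.coe_finset_sum_real, ← EReal.coe_neg, ← EReal.coe_mul, EReal.coe_le_coe_iff] at h1
    have h4 : ∏ x, tiltedBhat W Q' ρ x ^ Q x =
        Real.exp (∑ x, Q x * Real.log (tiltedBhat W Q' ρ x)) := by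
      rw [Real.exp_sum]
      refine Finset.prod_congr rfl fun x _ => ?_
      by_cases hx : Q x = 0
      · simp [hx]
      · have : 0 < tiltedBhat W Q' ρ x :=
          lt_of_le_of_ne (tiltedBhat_nonneg W hQ' ρ x) fun h => hx (hz x h.symm)
        rw [Real.rpow_def_of_pos this, mul_comm]
    rw [h4, Real.exp_le_exp, le_neg, div_le_iff₀ hρ]
    linarith

theorem ExpurgatedBound.le_mul_entH {X Y : Type*} [Fintype X] [Fintype Y] {W : X → Y → ℝ}
    (hW : IsDMC W) {Q : X → ℝ} (hQ : IsProbDist Q) {ρ s : ℝ} (hρ : 0 < ρ)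
    (h : ExpurgatedBound W Q ρ s) : s ≤ ρ * entH Q := by
  have h1 := h Q hQ
  have h2 : ∀ x, Q x ≤ tiltedBhat W Q ρ x := by
    intro x
    have := Finset.single_le_sum (f := fun x' => Q x' * bhat W x x' ^ (1 / ρ))
      (fun x' _ => mul_nonneg (hQ.1 x') (Real.rpow_nonneg (bhat_nonneg _ _ _) _))
      (Finset.mem_univ x)
    simpa [bhat_self hW, tiltedBhat] using this
  have h3 : Real.exp (-entH Q) ≤ ∏ x, tiltedBhat W Q ρ x ^ Q x := by
    unfold entH
    rw [← Finset.sum_neg_distrib, Real.exp_sum]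
    refine Finset.prod_le_prod (fun _ _ => (Real.exp_pos _).le) fun x _ => ?_
    refine le_trans (le_of_eq ?_) (Real.rpow_le_rpow (hQ.1 x) (h2 x) (hQ.1 x))
    rcases (hQ.1 x).eq_or_lt with h | h
    · simp [← h]
    · rw [Real.rpow_def_of_pos h, Real.negMulLog]
      congr 1
      ring
  have h4 := Real.exp_le_exp.mp (h3.trans h1)
  have : s / ρ ≤ entH Q := by linarith
  rw [div_le_iff₀ hρ] at this
  linarith

theorem ExpurgatedBound.of_mul_le {X Y : Type*} [Fintype X] [Fintype Y] {W : X → Y → ℝ}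
    (hW : IsDMC W) {Q Qh : X → ℝ} (hQ : IsProbDist Q) {ρ s ε : ℝ} (hρ : 0 < ρ)
    (hε : ε ≤ 1) (hle : ∀ x, (1 - ε) * Q x ≤ Qh x) (h : ExpurgatedBound W Q ρ s) :
    ExpurgatedBound W Qh ρ ((1 - ε) * s) := by
  intro Q' hQ'
  have h0 := fun x => tiltedBhat_nonneg W hQ' ρ x
  calc ∏ x, tiltedBhat W Q' ρ x ^ Qh x
      ≤ ∏ x, (tiltedBhat W Q' ρ x ^ Q x) ^ (1 - ε) := by
        refine Finset.prod_le_prod (fun x _ => Real.rpow_nonneg (h0 x) _) fun x _ => ?_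
        rw [← Real.rpow_mul (h0 x), mul_comm]
        exact Real.rpow_le_rpow_of_exponent_ge' (h0 x) (tiltedBhat_le_one hW hQ' hρ x)
          (mul_nonneg (by linarith) (hQ.1 x)) (hle x)
    _ = (∏ x, tiltedBhat W Q' ρ x ^ Q x) ^ (1 - ε) :=
        Real.finsetProd_rpow _ _ (fun x _ => Real.rpow_nonneg (h0 x) _) _
    _ ≤ (Real.exp (-(s / ρ))) ^ (1 - ε) :=
        Real.rpow_le_rpow (Finset.prod_nonneg fun x _ => Real.rpow_nonneg (h0 x) _) (h Q' hQ')
          (by linarith)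
    _ = Real.exp (-((1 - ε) * s / ρ)) := by
        rw [← Real.exp_mul]
        congr 1
        ring

/-- Bhattacharyya coefficient of two input blocks. -/
def blockBhat {X Y : Type*} [Fintype Y] (W : X → Y → ℝ) {n : ℕ} (x x' : Fin n → X) : ℝ :=
  ∏ l, bhat W (x l) (x' l)

theorem blockBhat_nonneg {X Y : Type*} [Fintype Y] (W : X → Y → ℝ) {n : ℕ} (x x' : Fin n → X) :
    0 ≤ blockBhat W x x' :=
  Finset.prod_nonneg fun _ _ => bhat_nonneg _ _ _

theorem blockBhat_comm {X Y : Type*} [Fintype Y] (W : X → Y → ℝ) {n : ℕ} (x x' : Fin n → X) :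
    blockBhat W x x' = blockBhat W x' x := by
  unfold blockBhat
  exact Finset.prod_congr rfl fun _ _ => bhat_comm _ _ _

theorem sum_sqrt_Wn_mul_Wn {X Y : Type*} [Fintype Y] {W : X → Y → ℝ} (hW : IsDMC W) {n : ℕ}
    (x x' : Fin n → X) :
    ∑ y : Fin n → Y, Real.sqrt (Wn W x y * Wn W x' y) = blockBhat W x x' := by
  classical
  unfold blockBhat bhat Wn
  rw [Finset.prod_univ_sum]
  simp only [Fintype.piFinset_univ]
  refine Finset.sum_congr rfl fun y _ => ?_
  rw [← Finset.prod_mul_distrib, Real.sqrt_eq_rpow,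
    ← Real.finsetProd_rpow _ _ fun l _ => mul_nonneg (hW.1 _ _) (hW.1 _ _)]
  simp only [Real.sqrt_eq_rpow]

/-- Average of the tilted block coefficient over a type class. -/
theorem sum_typeClass_blockBhat_le {X Y : Type*} [Fintype X] [Fintype Y] (W : X → Y → ℝ)
    {n : ℕ} (hn : 0 < n) {Q Q' : X → ℝ} {ρ s : ℝ} (h : ExpurgatedBound W Q ρ s)
    (hQ' : IsType n Q') {x : Fin n → X} (hx : x ∈ typeClass n Q) :
    ∑ x' ∈ typeClass n Q', blockBhat W x x' ^ (1 / ρ) ≤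
      typePoly X n * (typeClass n Q').card * Real.exp (-(n * s / ρ)) := by
  classical
  have hprob : IsProbDist Q' := by
    obtain ⟨v, rfl⟩ := hQ'
    exact empDist_isProbDist hn v
  rw [mem_typeClass] at hx
  have hpd : ∀ x' : Fin n → X, 0 ≤ prodDist Q' x' := fun x' =>
    Finset.prod_nonneg fun _ _ => hprob.1 _
  have hb : ∀ x' : Fin n → X, 0 ≤ blockBhat W x x' ^ (1 / ρ) := fun x' =>
    Real.rpow_nonneg (blockBhat_nonneg _ _ _) _
  have hA : 0 ≤ typePoly X n * (typeClass n Q').card :=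
    mul_nonneg (zero_le_one.trans (one_le_typePoly X n)) (Nat.cast_nonneg _)
  have h0 := fun x => tiltedBhat_nonneg W hprob ρ x
  have hsum : ∑ x' : Fin n → X, prodDist Q' x' * blockBhat W x x' ^ (1 / ρ) =
      (∏ a, tiltedBhat W Q' ρ a ^ Q a) ^ n := by
    have e1 : ∑ x' : Fin n → X, prodDist Q' x' * blockBhat W x x' ^ (1 / ρ) =
        ∏ l, tiltedBhat W Q' ρ (x l) := by
      unfold tiltedBhat
      rw [Finset.prod_univ_sum]
      simp only [Fintype.piFinset_univ]
      refine Finset.sum_congr rfl fun x' _ => ?_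
      unfold prodDist blockBhat
      rw [← Real.finsetProd_rpow _ _ fun l _ => bhat_nonneg _ _ _, ← Finset.prod_mul_distrib]
    rw [e1, prod_comp_eq_prod_pow_letterCount x (tiltedBhat W Q' ρ), ← Finset.prod_pow]
    refine Finset.prod_congr rfl fun a _ => ?_
    rw [← Real.rpow_mul_natCast (h0 a), ← Real.rpow_natCast, ← mul_empDist hn, hx, mul_comm]
  calc ∑ x' ∈ typeClass n Q', blockBhat W x x' ^ (1 / ρ)
      ≤ ∑ x' ∈ typeClass n Q', typePoly X n * (typeClass n Q').card *
          (prodDist Q' x' * blockBhat W x x' ^ (1 / ρ)) := by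
        refine Finset.sum_le_sum fun x' hx' => ?_
        rw [mem_typeClass] at hx'
        have := one_le_typePoly_mul_card_mul_prodDist hn x'
        rw [hx'] at this
        rw [← mul_assoc]
        exact le_mul_of_one_le_left (hb x') this
    _ ≤ ∑ x' : Fin n → X, typePoly X n * (typeClass n Q').card *
          (prodDist Q' x' * blockBhat W x x' ^ (1 / ρ)) :=
        Finset.sum_le_sum_of_subset_of_nonneg (Finset.subset_univ _) fun x' _ _ =>
          mul_nonneg hA (mul_nonneg (hpd x') (hb x'))
    _ = typePoly X n * (typeClass n Q').card * (∏ a, tiltedBhat W Q' ρ a ^ Q a) ^ n := by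
        rw [← Finset.mul_sum, hsum]
    _ ≤ typePoly X n * (typeClass n Q').card * Real.exp (-(s / ρ)) ^ n := by
        refine mul_le_mul_of_nonneg_left (pow_le_pow_left₀ ?_ (h Q' hprob) n) hA
        exact Finset.prod_nonneg fun a _ => Real.rpow_nonneg (h0 a) _
    _ = _ := by
        rw [← Real.exp_nat_mul]
        congr 2
        ring

/-! ### The source function -/

theorem prodDist_congr {α : Type*} [Fintype α] (P : α → ℝ) {k : ℕ} {v w : Fin k → α}
    (h : empDist v = empDist w) : prodDist P v = prodDist P w := by
  unfold prodDist
  rw [prod_comp_eq_prod_pow_letterCount v P, prod_comp_eq_prod_pow_letterCount w P]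
  refine Finset.prod_congr rfl fun a _ => ?_
  rcases Nat.eq_zero_or_pos k with hk | hk
  · have h1 := letterCount_le v a
    have h2 := letterCount_le w a
    rw [show letterCount v a = letterCount w a by omega]
  · have : (letterCount v a : ℝ) = letterCount w a := by
      rw [← mul_empDist hk, ← mul_empDist hk, h]
    rw [Nat.cast_inj.mp this]

theorem one_le_sum_rpow {α : Type*} [Fintype α] {P : α → ℝ} (hP : IsProbDist P) {lam : ℝ}
    (hl : 0 ≤ lam) : 1 ≤ ∑ v, P v ^ (1 / (1 + lam)) := by
  refine hP.2.symm.le.trans (Finset.sum_le_sum fun v _ => ?_)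
  have h1 : P v ≤ 1 := by
    rw [← hP.2]
    exact Finset.single_le_sum (fun a _ => hP.1 a) (Finset.mem_univ v)
  conv_lhs => rw [← Real.rpow_one (P v)]
  exact Real.rpow_le_rpow_of_exponent_ge' (hP.1 v) h1 (by positivity)
    ((div_le_one (by linarith)).mpr (by linarith))

theorem Es_nonneg {α : Type*} [Fintype α] {P : α → ℝ} (hP : IsProbDist P) {lam : ℝ}
    (hl : 0 ≤ lam) : 0 ≤ Es P lam :=
  mul_nonneg (by linarith) (Real.log_nonneg (one_le_sum_rpow hP hl))

/-- Chernoff-type bound on the probability of a source sequence through the size of its type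
class. -/
theorem prodDist_mul_typeSize_rpow_le {α : Type*} [Fintype α] {P : α → ℝ} (hP : IsProbDist P)
    {lam : ℝ} (hl : 0 ≤ lam) {k : ℕ} (v : Fin k → α) :
    prodDist P v * (typeSize v : ℝ) ^ (1 + lam) ≤ Real.exp (k * Es P lam) := by
  classical
  have hpd : ∀ w : Fin k → α, 0 ≤ prodDist P w := fun w =>
    Finset.prod_nonneg fun _ _ => hP.1 _
  have hS : 0 < ∑ v, P v ^ (1 / (1 + lam)) := zero_lt_one.trans_le (one_le_sum_rpow hP hl)
  have hl' : 0 < 1 + lam := by linarith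
  have h1 : (typeSize v : ℝ) * prodDist P v ^ (1 / (1 + lam)) ≤
      (∑ v, P v ^ (1 / (1 + lam))) ^ k := by
    calc (typeSize v : ℝ) * prodDist P v ^ (1 / (1 + lam))
        = ∑ w ∈ typeClass k (empDist v), prodDist P w ^ (1 / (1 + lam)) := by
          rw [Finset.sum_congr rfl (g := fun _ => prodDist P v ^ (1 / (1 + lam)))]
          · rw [Finset.sum_const, nsmul_eq_mul]
            rfl
          · intro w hw
            rw [prodDist_congr P (mem_typeClass.mp hw)]
      _ ≤ ∑ w : Fin k → α, prodDist P w ^ (1 / (1 + lam)) :=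
          Finset.sum_le_sum_of_subset_of_nonneg (Finset.subset_univ _) fun w _ _ =>
            Real.rpow_nonneg (hpd w) _
      _ = ∏ _i : Fin k, ∑ v, P v ^ (1 / (1 + lam)) := by
          rw [Finset.prod_univ_sum]
          simp only [Fintype.piFinset_univ]
          refine Finset.sum_congr rfl fun w _ => ?_
          unfold prodDist
          rw [← Real.finsetProd_rpow _ _ fun l _ => hP.1 _]
      _ = _ := by simp
  have h2 := Real.rpow_le_rpow (mul_nonneg (Nat.cast_nonneg _) (Real.rpow_nonneg (hpd v) _)) h1
    hl'.le
  rw [Real.mul_rpow (Nat.cast_nonneg _) (Real.rpow_nonneg (hpd v) _), ← Real.rpow_mul (hpd v),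
    one_div, inv_mul_cancel₀ hl'.ne', Real.rpow_one] at h2
  rw [mul_comm]
  refine h2.trans (le_of_eq ?_)
  rw [Real.rpow_def_of_pos (pow_pos (by rw [← one_div]; exact hS) k), Real.log_pow, Es, one_div]
  congr 1
  ring

/-! ### Finitely many exponent parameters suffice -/

theorem exists_expurgatedBound_of_lt_ExBar {X Y : Type*} [Fintype X] [Fintype Y]
    {W : X → Y → ℝ} {m : ℕ} {Qs : Fin m → X → ℝ} {lam a : ℝ}
    (ha : (a : EReal) < ExBar W Qs lam) {R : ℝ} (hR : 0 ≤ R) :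
    ∃ (c : Fin m) (ρ s : ℝ), 1 ≤ ρ ∧ ExpurgatedBound W (Qs c) ρ s ∧ a < s + (lam - ρ) * R := by
  have h1 := ha.trans_le (iInf₂_le R hR)
  rw [lt_iSup_iff] at h1
  obtain ⟨ρ, h1⟩ := h1
  rw [lt_iSup_iff] at h1
  obtain ⟨hρ, h1⟩ := h1
  have h2 : ((a - (lam - ρ) * R : ℝ) : EReal) < ⨆ c, Ex' W (Qs c) ρ := by
    rw [EReal.coe_sub]
    exact EReal.sub_lt_of_lt_add h1
  rw [lt_iSup_iff] at h2
  obtain ⟨c, hc⟩ := h2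
  obtain ⟨s, hs1, hs2⟩ := EReal.exists_between_coe_real hc
  rw [EReal.coe_lt_coe_iff] at hs1
  exact ⟨c, ρ, s, hρ, expurgatedBound_of_le_Ex' W (by linarith) hs2.le, by linarith⟩

/-- Compactness in the rate: finitely many choices `(c, ρ, s, h)` of a class, a parameter, an
exponent and an entropy bound cover all rates in `[0, Rmax]`, except those with `a < λR`. -/
theorem exists_finite_exponent_cover {X Y : Type*} [Fintype X] [Fintype Y]
    {W : X → Y → ℝ} (hW : IsDMC W) {m : ℕ} {Qs : Fin m → X → ℝ} (hQs : ∀ c, IsProbDist (Qs c))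
    {lam a : ℝ} (ha : (a : EReal) < ExBar W Qs lam) (Rmax : ℝ) :
    ∃ (F : Finset ℝ) (c : ℝ → Fin m) (ρ s h : ℝ → ℝ),
      (∀ i ∈ F, 1 ≤ ρ i ∧ ExpurgatedBound W (Qs (c i)) (ρ i) (s i) ∧ h i < entH (Qs (c i))) ∧
      ∀ R ∈ Set.Icc 0 Rmax, ∃ i ∈ F, a < lam * R ∨ (a < s i + (lam - ρ i) * R ∧ R < h i) := by
  have key : ∀ R₀ : ℝ, 0 ≤ R₀ → ∃ (c : Fin m) (ρ s h : ℝ), 1 ≤ ρ ∧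
      ExpurgatedBound W (Qs c) ρ s ∧ h < entH (Qs c) ∧
      ∀ᶠ R in 𝓝 R₀, a < lam * R ∨ (a < s + (lam - ρ) * R ∧ R < h) := by
    intro R₀ hR₀
    obtain ⟨c, ρ, s, hρ, hs, hlt⟩ := exists_expurgatedBound_of_lt_ExBar ha hR₀
    by_cases hH : R₀ < entH (Qs c)
    · obtain ⟨h, hh1, hh2⟩ := exists_between hH
      refine ⟨c, ρ, s, h, hρ, hs, hh2, ?_⟩
      have h1 : ∀ᶠ R in 𝓝 R₀, a < s + (lam - ρ) * R :=
        continuousAt_const.eventually_lt (by fun_prop) hlt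
      filter_upwards [h1, eventually_lt_nhds hh1] with R h2 h3 using Or.inr ⟨h2, h3⟩
    · refine ⟨c, ρ, s, entH (Qs c) - 1, hρ, hs, by linarith, ?_⟩
      have h0 : a < lam * R₀ := by
        have := hs.le_mul_entH hW (hQs c) (by linarith)
        nlinarith
      have h1 : ∀ᶠ R in 𝓝 R₀, a < lam * R :=
        continuousAt_const.eventually_lt (by fun_prop) h0
      filter_upwards [h1] with R h2 using Or.inl h2
  have key' : ∀ R₀ : ℝ, ∃ (c : Fin m) (ρ s h : ℝ), 0 ≤ R₀ → 1 ≤ ρ ∧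
      ExpurgatedBound W (Qs c) ρ s ∧ h < entH (Qs c) ∧
      ∀ᶠ R in 𝓝 R₀, a < lam * R ∨ (a < s + (lam - ρ) * R ∧ R < h) := by
    intro R₀
    by_cases hR₀ : 0 ≤ R₀
    · obtain ⟨c, ρ, s, h, hh⟩ := key R₀ hR₀
      exact ⟨c, ρ, s, h, fun _ => hh⟩
    · obtain ⟨c, -⟩ := key 0 le_rfl
      exact ⟨c, 0, 0, 0, fun h => absurd h hR₀⟩
  choose c ρ s h hh using key'
  obtain ⟨F, hF, hcov⟩ := (isCompact_Icc (a := (0 : ℝ)) (b := Rmax)).elim_nhds_subcover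
    (fun R₀ => {R | a < lam * R ∨ (a < s R₀ + (lam - ρ R₀) * R ∧ R < h R₀)})
    (fun R₀ hR₀ => (hh R₀ hR₀.1).2.2.2)
  refine ⟨F, c, ρ, s, h, fun i hi => ?_, fun R hR => ?_⟩
  · have := hh i (hF i hi).1
    exact ⟨this.1, this.2.1, this.2.2.1⟩
  · have := hcov hR
    simp only [Set.mem_iUnion] at this
    obtain ⟨i, hi, hcase⟩ := this
    exact ⟨i, hi, hcase⟩

/-! ### Code construction -/

open scoped Classical in
/-- Greedy choice along a well-founded relation: each element is placed so that its total
interaction with its predecessors does not exceed the average. -/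
theorem exists_greedy_choice {M Z : Type*} [Fintype M] {r : M → M → Prop} (wf : WellFounded r)
    (T : M → Finset Z) (hT : ∀ v, (T v).Nonempty) (K : M → Z → Z → ℝ) (κ : M → ℝ)
    (hκ : ∀ v, 0 ≤ κ v)
    (h : ∀ v v', ∀ z ∈ T v, ∑ z' ∈ T v', K v z z' ≤ (T v').card * κ v) :
    ∃ f : M → Z, (∀ v, f v ∈ T v) ∧
      ∀ v', ∑ v ∈ Finset.univ.filter (fun v => r v v'), K v (f v) (f v') ≤ ∑ v, κ v := by
  have step : ∀ (v' : M) (g : ∀ v, {z // z ∈ T v}), ∃ z' : {z // z ∈ T v'},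
      ∑ v ∈ Finset.univ.filter (fun v => r v v'), K v (g v) z' ≤ ∑ v, κ v := by
    intro v' g
    have hsum : ∑ z' ∈ T v', ∑ v ∈ Finset.univ.filter (fun v => r v v'), K v (g v) z' ≤
        ∑ _z' ∈ T v', ∑ v, κ v := by
      rw [Finset.sum_comm, Finset.sum_const, nsmul_eq_mul, Finset.mul_sum]
      refine (Finset.sum_le_sum fun v _ => h v v' _ (g v).2).trans ?_
      exact Finset.sum_le_sum_of_subset_of_nonneg (Finset.subset_univ _) fun v _ _ =>
        mul_nonneg (Nat.cast_nonneg _) (hκ v)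
    obtain ⟨z', hz', hle⟩ := Finset.exists_le_of_sum_le (hT v') hsum
    exact ⟨⟨z', hz'⟩, hle⟩
  choose G hG using step
  let F : ∀ v', (∀ v, r v v' → {z // z ∈ T v}) → {z // z ∈ T v'} := fun v' rec =>
    G v' fun v => if hv : r v v' then rec v hv else ⟨(hT v).choose, (hT v).choose_spec⟩
  let f : ∀ v, {z // z ∈ T v} := wf.fix F
  refine ⟨fun v => f v, fun v => (f v).2, fun v' => ?_⟩
  have hf : f v' = F v' fun v _ => f v := wf.fix_eq F v'
  beta_reduce
  rw [hf]
  refine le_trans (le_of_eq ?_) (hG v' fun v => if r v v' then f v else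
    ⟨(hT v).choose, (hT v).choose_spec⟩)
  refine Finset.sum_congr rfl fun v hv => ?_
  have hv' : r v v' := (Finset.mem_filter.mp hv).2
  simp only [F, hv', if_true, dite_eq_ite]

theorem sum_Wn {X Y : Type*} [Fintype Y] {W : X → Y → ℝ} (hW : IsDMC W) {n : ℕ}
    (x : Fin n → X) : ∑ y : Fin n → Y, Wn W x y = 1 := by
  classical
  have h := Finset.prod_univ_sum (fun _ : Fin n => (Finset.univ : Finset Y))
    (fun l y => W (x l) y)
  simp only [Fintype.piFinset_univ, hW.2, Finset.prod_const_one] at h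
  exact h.symm

theorem Wn_nonneg {X Y : Type*} [Fintype Y] {W : X → Y → ℝ} (hW : IsDMC W) {n : ℕ}
    (x : Fin n → X) (y : Fin n → Y) : 0 ≤ Wn W x y :=
  Finset.prod_nonneg fun _ _ => hW.1 _ _

theorem prodDist_nonneg {α : Type*} [Fintype α] {P : α → ℝ} (hP : IsProbDist P) {k : ℕ}
    (v : Fin k → α) : 0 ≤ prodDist P v :=
  Finset.prod_nonneg fun _ _ => hP.1 _

open scoped Classical in
/-- Bhattacharyya union bound for the maximum a posteriori decoder restricted to the source
sequences in `G`. -/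
theorem exists_decoder_pErr_le {V X Y : Type*} [Fintype V] [Fintype Y]
    {PV : V → ℝ} (hPV : IsProbDist PV) {W : X → Y → ℝ} (hW : IsDMC W) {k n : ℕ}
    (f : (Fin k → V) → Fin n → X) (G : Finset (Fin k → V)) :
    ∃ φ : (Fin n → Y) → Fin k → V, pErr PV W f φ ≤ ∑ v ∈ Gᶜ, prodDist PV v +
      ∑ v ∈ G, ∑ v' ∈ G.erase v,
        Real.sqrt (prodDist PV v * prodDist PV v') * blockBhat W (f v) (f v') := by
  have hV : Nonempty V := by
    by_contra h
    rw [not_nonempty_iff] at h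
    have := hPV.2
    simp at this
  have hdec : ∀ y : Fin n → Y, ∃ w : Fin k → V, ∀ v ∈ G,
      w ∈ G ∧ prodDist PV v * Wn W (f v) y ≤ prodDist PV w * Wn W (f w) y := by
    intro y
    rcases G.eq_empty_or_nonempty with rfl | hne
    · exact ⟨fun _ => hV.some, by simp⟩
    · obtain ⟨w, hw, hmax⟩ := G.exists_max_image (fun v => prodDist PV v * Wn W (f v) y) hne
      exact ⟨w, fun v hv => ⟨hw, hmax v hv⟩⟩
  choose φ hφ using hdec
  have hp := fun v : Fin k → V => prodDist_nonneg hPV v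
  refine ⟨φ, ?_⟩
  unfold pErr
  rw [← Finset.sum_add_sum_compl G, add_comm]
  refine add_le_add (Finset.sum_le_sum fun v _ => ?_) (Finset.sum_le_sum fun v hv => ?_)
  · refine mul_le_of_le_one_right (hp v) ?_
    rw [← sum_Wn hW (f v)]
    exact Finset.sum_le_sum_of_subset_of_nonneg (Finset.subset_univ _) fun y _ _ =>
      Wn_nonneg hW _ _
  · have hterm : ∀ y ∈ Finset.univ.filter (fun y : Fin n → Y => φ y ≠ v),
        prodDist PV v * Wn W (f v) y ≤ ∑ v' ∈ G.erase v,
          Real.sqrt (prodDist PV v * prodDist PV v') *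
            Real.sqrt (Wn W (f v) y * Wn W (f v') y) := by
      intro y hy
      obtain ⟨hw, hle⟩ := hφ y v hv
      have hne : φ y ≠ v := (Finset.mem_filter.mp hy).2
      refine le_trans ?_ (Finset.single_le_sum (f := fun v' =>
        Real.sqrt (prodDist PV v * prodDist PV v') * Real.sqrt (Wn W (f v) y * Wn W (f v') y))
        (fun _ _ => by positivity) (Finset.mem_erase.mpr ⟨hne, hw⟩))
      have hnn : 0 ≤ prodDist PV v * Wn W (f v) y := mul_nonneg (hp v) (Wn_nonneg hW _ _)
      rw [← Real.sqrt_mul (mul_nonneg (hp v) (hp _))]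
      refine Real.le_sqrt_of_sq_le ?_
      calc (prodDist PV v * Wn W (f v) y) ^ 2
          = (prodDist PV v * Wn W (f v) y) * (prodDist PV v * Wn W (f v) y) := sq _
        _ ≤ (prodDist PV v * Wn W (f v) y) * (prodDist PV (φ y) * Wn W (f (φ y)) y) :=
            mul_le_mul_of_nonneg_left hle hnn
        _ = _ := by ring
    rw [Finset.mul_sum]
    refine (Finset.sum_le_sum hterm).trans ?_
    refine (Finset.sum_le_sum_of_subset_of_nonneg (Finset.subset_univ _) fun y _ _ =>
      Finset.sum_nonneg fun _ _ => by positivity).trans (le_of_eq ?_)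
    rw [Finset.sum_comm]
    refine Finset.sum_congr rfl fun v' _ => ?_
    rw [← Finset.mul_sum, sum_sqrt_Wn_mul_Wn hW]

open scoped Classical in
/-- A symmetric sum over distinct pairs is at most twice the sum over the pairs ordered by a
total relation. -/
theorem sum_erase_le_two_mul_sum_filter {M : Type*} [DecidableEq M] {r : M → M → Prop}
    (hr : ∀ v v', v ≠ v' → r v v' ∨ r v' v) (G : Finset M) (S : M → M → ℝ)
    (hS : ∀ v v', 0 ≤ S v v') (hsymm : ∀ v v', S v v' = S v' v) :
    ∑ v ∈ G, ∑ v' ∈ G.erase v, S v v' ≤ 2 * ∑ v' ∈ G, ∑ v ∈ G.filter (fun v => r v v'), S v v' := by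
  have h1 : ∀ v ∈ G, ∑ v' ∈ G.erase v, S v v' ≤
      ∑ v' ∈ G.filter (fun v' => r v v'), S v v' + ∑ v' ∈ G.filter (fun v' => r v' v), S v v' := by
    intro v _
    rw [← Finset.sum_union_inter]
    have h0 : 0 ≤ ∑ v' ∈ G.filter (fun v' => r v v') ∩ G.filter (fun v' => r v' v), S v v' :=
      Finset.sum_nonneg fun _ _ => hS _ _
    refine le_trans (Finset.sum_le_sum_of_subset_of_nonneg ?_ fun _ _ _ => hS _ _)
      (le_add_of_nonneg_right h0)
    intro v' hv'
    obtain ⟨hne, hmem⟩ := Finset.mem_erase.mp hv'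
    rw [Finset.mem_union, Finset.mem_filter, Finset.mem_filter]
    exact (hr v v' hne.symm).imp (fun h => ⟨hmem, h⟩) fun h => ⟨hmem, h⟩
  refine (Finset.sum_le_sum h1).trans (le_of_eq ?_)
  rw [Finset.sum_add_distrib, two_mul]
  congr 1
  · simp only [Finset.sum_filter]
    exact Finset.sum_comm
  · exact Finset.sum_congr rfl fun v _ => Finset.sum_congr rfl fun v' _ => hsymm _ _

theorem sqrt_mul_mul_rpow_mul_le {p p' M M' A lam : ℝ} (hp : 0 ≤ p) (hp' : 0 ≤ p') (hM : 0 < M)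
    (hMM' : M ≤ M') (hlam : 1 ≤ lam) (h : p * M ^ (1 + lam) ≤ A) (h' : p' * M' ^ (1 + lam) ≤ A) :
    Real.sqrt (p * p') * (M ^ lam * M') ≤ A := by
  have hM' : 0 < M' := hM.trans_le hMM'
  have hA : 0 ≤ A := le_trans (by positivity) h
  have e1 : M ^ (1 + lam) = M * M ^ lam := by rw [Real.rpow_add hM, Real.rpow_one]
  have e2 : M' ^ (1 + lam) = M' ^ 2 * M' ^ (lam - 1) := by
    rw [← Real.rpow_natCast M' 2, ← Real.rpow_add hM']
    congr 1
    push_cast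
    ring
  have e3 : M ^ lam = M * M ^ (lam - 1) := by
    conv_rhs => rw [← Real.rpow_one M, ← Real.rpow_mul hM.le, one_mul, ← Real.rpow_add hM]
    congr 1
    ring
  have h3 : M ^ (lam - 1) ≤ M' ^ (lam - 1) := Real.rpow_le_rpow hM.le hMM' (by linarith)
  refine le_of_sq_le_sq ?_ hA
  rw [mul_pow, Real.sq_sqrt (mul_nonneg hp hp')]
  calc p * p' * (M ^ lam * M') ^ 2 = (p * (M * M ^ lam)) * (p' * (M' ^ 2 * M ^ (lam - 1))) := by
        rw [e3]; ring
    _ ≤ (p * (M * M ^ lam)) * (p' * (M' ^ 2 * M' ^ (lam - 1))) := by gcongr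
    _ ≤ A * A := by
        rw [e1] at h
        rw [e2] at h'
        exact mul_le_mul h h' (by positivity) hA
    _ = A ^ 2 := (sq A).symm

/-- A finite type is well-ordered compatibly with a given size function. -/
theorem exists_order_by_nat {M : Type*} [Fintype M] (g : M → ℕ) :
    ∃ r : M → M → Prop, WellFounded r ∧ (∀ v w, v ≠ w → r v w ∨ r w v) ∧
      ∀ v w, r v w → g v ≤ g w := by
  let key : M → ℕ ×ₗ ℕ := fun v => toLex (g v, (Fintype.equivFin _ v : ℕ))
  have hkey : Function.Injective key := by
    intro v w h
    have h' : (g v, (Fintype.equivFin _ v : ℕ)) = (g w, (Fintype.equivFin _ w : ℕ)) :=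
      toLex.injective h
    exact (Fintype.equivFin _).injective (Fin.ext (Prod.ext_iff.mp h').2)
  refine ⟨fun v w => key v < key w, InvImage.wf key wellFounded_lt,
    fun v w h => lt_or_gt_of_ne (hkey.ne h), fun v w h => ?_⟩
  have hlex : g v < g w ∨ _ := Prod.Lex.toLex_lt_toLex.mp h
  rcases hlex with hlt | heq
  · exact hlt.le
  · exact heq.1.le

/-- Existence of a code whose error probability is controlled by the sizes of the source type
classes. The sequences outside `G` are given up; those in `G` are encoded greedily in the order
of increasing type class size. -/
theorem exists_code_pErr_le {V X Y : Type*} [Fintype V] [Fintype X] [Fintype Y]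
    {PV : V → ℝ} (hPV : IsProbDist PV) {W : X → Y → ℝ} (hW : IsDMC W) {k n : ℕ}
    {lam : ℝ} (hlam : 1 ≤ lam) (G : Finset (Fin k → V)) (Qt : (Fin k → V) → X → ℝ)
    (hQt : ∀ v, IsType n (Qt v)) (ρ β : (Fin k → V) → ℝ) {ρm K N η : ℝ}
    (hρ : ∀ v ∈ G, 1 ≤ ρ v ∧ ρ v ≤ ρm) (hβ : ∀ v ∈ G, 0 < β v) (hK : 1 ≤ K) (hN : 1 ≤ N)
    (hNsum : ∑ v : Fin k → V, ((typeSize v : ℝ))⁻¹ ≤ N) (hη : 0 < η)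
    (havg : ∀ v ∈ G, ∀ x ∈ typeClass n (Qt v), ∀ Q', IsType n Q' →
      ∑ x' ∈ typeClass n Q', blockBhat W x x' ^ (1 / ρ v) ≤ K * (typeClass n Q').card * β v)
    (hG : ∀ v ∈ G, ((typeSize v : ℝ) * β v) ^ ρ v ≤ η * (typeSize v : ℝ) ^ lam)
    (hJ : ∀ v, v ∉ G → 1 ≤ η * (typeSize v : ℝ) ^ lam) :
    ∃ (f : (Fin k → V) → Fin n → X) (φ : (Fin n → Y) → Fin k → V),
      (∀ v, f v ∈ typeClass n (Qt v)) ∧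
      pErr PV W f φ ≤ Real.exp (k * Es PV lam) * η * (N + 2 * ((K * N) ^ ρm * N)) := by
  classical
  set A := Real.exp (k * Es PV lam) with hA
  have hA0 : 0 < A := Real.exp_pos _
  have hM : ∀ v : Fin k → V, (0 : ℝ) < typeSize v := fun v => by exact_mod_cast typeSize_pos v
  have hp := fun v : Fin k → V => prodDist_nonneg hPV v
  have hpA : ∀ v : Fin k → V, prodDist PV v * (typeSize v : ℝ) ^ (1 + lam) ≤ A := fun v =>
    prodDist_mul_typeSize_rpow_le hPV (by linarith) v
  obtain ⟨r, wf, hr, hrM⟩ := exists_order_by_nat (typeSize : (Fin k → V) → ℕ)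
  let b : (Fin k → V) → (Fin n → X) → (Fin n → X) → ℝ := fun v x x' =>
    if v ∈ G then blockBhat W x x' ^ (1 / ρ v) / (typeSize v * β v) else 0
  have hb0 : ∀ v x x', 0 ≤ b v x x' := by
    intro v x x'
    by_cases hv : v ∈ G
    · simp only [b, if_pos hv]
      exact div_nonneg (Real.rpow_nonneg (blockBhat_nonneg _ _ _) _)
        (mul_pos (hM v) (hβ v hv)).le
    · simp only [b, if_neg hv, le_refl]
  obtain ⟨f, hf, hgreedy⟩ := exists_greedy_choice wf (fun v => typeClass n (Qt v))
    (fun v => by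
      obtain ⟨x, hx⟩ := hQt v
      exact ⟨x, mem_typeClass.mpr hx⟩)
    b (fun v => K * ((typeSize v : ℝ))⁻¹)
    (fun v => mul_nonneg (by linarith) (inv_nonneg.mpr (hM v).le)) (by
      intro v v' x hx
      have := hM v
      by_cases hv : v ∈ G
      · have hβv := hβ v hv
        simp only [b, if_pos hv]
        rw [← Finset.sum_div, div_le_iff₀ (by positivity)]
        refine (havg v hv x hx _ (hQt v')).trans (le_of_eq ?_)
        field_simp
      · simp only [b, if_neg hv, Finset.sum_const_zero]
        positivity)
  obtain ⟨φ, hφ⟩ := exists_decoder_pErr_le hPV hW f G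
  refine ⟨f, φ, hf, hφ.trans ?_⟩
  set L := K * N with hL
  have hL1 : 1 ≤ L := one_le_mul_of_one_le_of_one_le hK hN
  have hsumL : ∀ v', ∑ v ∈ Finset.univ.filter (fun v => r v v'), b v (f v) (f v') ≤ L := by
    intro v'
    refine (hgreedy v').trans ?_
    rw [← Finset.mul_sum]
    exact mul_le_mul_of_nonneg_left hNsum (by linarith)
  have hjunk : ∑ v ∈ Gᶜ, prodDist PV v ≤ A * η * N := by
    calc ∑ v ∈ Gᶜ, prodDist PV v ≤ ∑ v ∈ Gᶜ, A * η * ((typeSize v : ℝ))⁻¹ := by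
          refine Finset.sum_le_sum fun v hv => ?_
          have h1 := hJ v (Finset.mem_compl.mp hv)
          have h2 := hpA v
          rw [Real.rpow_add (hM v), Real.rpow_one] at h2
          rw [← div_eq_mul_inv, le_div_iff₀ (hM v)]
          calc prodDist PV v * typeSize v
              ≤ prodDist PV v * typeSize v * (η * (typeSize v : ℝ) ^ lam) :=
                le_mul_of_one_le_right (mul_nonneg (hp v) (hM v).le) h1
            _ = η * (prodDist PV v * (typeSize v * (typeSize v : ℝ) ^ lam)) := by ring
            _ ≤ η * A := mul_le_mul_of_nonneg_left h2 hη.le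
            _ = A * η := mul_comm _ _
      _ ≤ ∑ v, A * η * ((typeSize v : ℝ))⁻¹ :=
          Finset.sum_le_sum_of_subset_of_nonneg (Finset.subset_univ _) fun v _ _ => by
            have := hM v
            positivity
      _ ≤ A * η * N := by
          rw [← Finset.mul_sum]
          exact mul_le_mul_of_nonneg_left hNsum (by positivity)
  have hpair : ∀ v' ∈ G, ∀ v ∈ G.filter (fun v => r v v'),
      Real.sqrt (prodDist PV v * prodDist PV v') * blockBhat W (f v) (f v') ≤
        A * η * L ^ (ρm - 1) * ((typeSize v' : ℝ))⁻¹ * b v (f v) (f v') := by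
    intro v' _ v hv
    obtain ⟨hvG, hrv⟩ := Finset.mem_filter.mp hv
    have hMv := hM v
    have hMv' := hM v'
    have hβv := hβ v hvG
    obtain ⟨hρ1, hρ2⟩ := hρ v hvG
    have hbb := hb0 v (f v) (f v')
    have hbL : b v (f v) (f v') ≤ L := by
      refine le_trans ?_ (hsumL v')
      exact Finset.single_le_sum (f := fun v => b v (f v) (f v')) (fun v _ => hb0 v _ _)
        (Finset.mem_filter.mpr ⟨Finset.mem_univ v, hrv⟩)
    have hB : blockBhat W (f v) (f v') =
        b v (f v) (f v') ^ ρ v * ((typeSize v : ℝ) * β v) ^ ρ v := by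
      rw [← Real.mul_rpow hbb (by positivity)]
      simp only [b, if_pos hvG]
      rw [div_mul_cancel₀ _ (by positivity), ← Real.rpow_mul (blockBhat_nonneg _ _ _),
        one_div, inv_mul_cancel₀ (by linarith), Real.rpow_one]
    have hbρ : b v (f v) (f v') ^ ρ v ≤ b v (f v) (f v') * L ^ (ρm - 1) := by
      have : ρ v = 1 + (ρ v - 1) := by ring
      rw [this, Real.rpow_add_of_nonneg hbb (by linarith) (by linarith), Real.rpow_one]
      refine mul_le_mul_of_nonneg_left ?_ hbb
      exact (Real.rpow_le_rpow hbb hbL (by linarith)).trans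
        (Real.rpow_le_rpow_of_exponent_le hL1 (by linarith))
    have hsq := sqrt_mul_mul_rpow_mul_le (hp v) (hp v') hMv (Nat.cast_le.mpr (hrM v v' hrv)) hlam (hpA v) (hpA v')
    have hLpos : 0 < L := by linarith
    calc Real.sqrt (prodDist PV v * prodDist PV v') * blockBhat W (f v) (f v')
        ≤ Real.sqrt (prodDist PV v * prodDist PV v') *
            ((b v (f v) (f v') * L ^ (ρm - 1)) * (η * (typeSize v : ℝ) ^ lam)) := by
          rw [hB]
          refine mul_le_mul_of_nonneg_left ?_ (Real.sqrt_nonneg _)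
          exact mul_le_mul hbρ (hG v hvG) (by positivity) (by positivity)
      _ = (Real.sqrt (prodDist PV v * prodDist PV v') *
            ((typeSize v : ℝ) ^ lam * typeSize v')) *
            (η * L ^ (ρm - 1) * ((typeSize v' : ℝ))⁻¹ * b v (f v) (f v')) := by
          field_simp
      _ ≤ A * (η * L ^ (ρm - 1) * ((typeSize v' : ℝ))⁻¹ * b v (f v) (f v')) :=
          mul_le_mul_of_nonneg_right hsq (by positivity)
      _ = _ := by ring
  have hmain : ∑ v' ∈ G, ∑ v ∈ G.filter (fun v => r v v'),
      Real.sqrt (prodDist PV v * prodDist PV v') * blockBhat W (f v) (f v') ≤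
        A * η * (L ^ ρm * N) := by
    have hLpos : 0 < L := by linarith
    have hLe : L ^ (ρm - 1) * L = L ^ ρm := by
      conv_lhs => rw [← Real.rpow_one L, ← Real.rpow_mul hLpos.le, one_mul, ← Real.rpow_add hLpos]
      congr 1
      ring
    calc _ ≤ ∑ v' ∈ G, A * η * L ^ ρm * ((typeSize v' : ℝ))⁻¹ := by
          refine Finset.sum_le_sum fun v' hv' => ?_
          have := hM v'
          refine (Finset.sum_le_sum (hpair v' hv')).trans ?_
          rw [← Finset.mul_sum]
          have hsub : ∑ v ∈ G.filter (fun v => r v v'), b v (f v) (f v') ≤ L :=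
            (Finset.sum_le_sum_of_subset_of_nonneg
              (Finset.filter_subset_filter _ (Finset.subset_univ G))
              fun v _ _ => hb0 v _ _).trans (hsumL v')
          refine (mul_le_mul_of_nonneg_left hsub (by positivity)).trans (le_of_eq ?_)
          rw [← hLe]
          ring
      _ ≤ ∑ v', A * η * L ^ ρm * ((typeSize v' : ℝ))⁻¹ :=
          Finset.sum_le_sum_of_subset_of_nonneg (Finset.subset_univ _) fun v _ _ => by
            have := hM v
            positivity
      _ ≤ A * η * L ^ ρm * N := by
          rw [← Finset.mul_sum]
          exact mul_le_mul_of_nonneg_left hNsum (by positivity)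
      _ = _ := by ring
  have h2 := sum_erase_le_two_mul_sum_filter hr G
    (fun v v' => Real.sqrt (prodDist PV v * prodDist PV v') * blockBhat W (f v) (f v'))
    (fun v v' => mul_nonneg (Real.sqrt_nonneg _) (blockBhat_nonneg _ _ _))
    (fun v v' => by rw [mul_comm (prodDist PV v), blockBhat_comm])
  refine (add_le_add hjunk (h2.trans (mul_le_mul_of_nonneg_left hmain zero_le_two))).trans
    (le_of_eq ?_)
  ring

/-! ### Asymptotics and assembly -/

/-- Polynomial factor bounding both the number of source types and the type class comparison is
subexponential. -/
theorem eventually_typePoly_mul_le_exp (X V : Type*) [Fintype X] [Fintype V] {t : ℝ} (ht : 0 < t)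
    {γ : ℝ} (hγ : 0 < γ) :
    ∀ᶠ n : ℕ in atTop, typePoly X n * ((⌊t * (n : ℝ)⌋₊ : ℝ) + 1) ^ Fintype.card V ≤
      Real.exp (n * γ) := by
  set d := Fintype.card X + Fintype.card V with hd
  set C : ℝ := Real.exp 1 ^ Fintype.card X * (t + 1) ^ Fintype.card V with hC
  have hC0 : 0 < C := by positivity
  have h1 : ∀ᶠ x : ℝ in atTop, ‖x ^ d‖ ≤ C⁻¹ * ‖Real.exp (γ / 2 * x)‖ :=
    (isLittleO_pow_exp_pos_mul_atTop d (half_pos hγ)).def (inv_pos.mpr hC0)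
  have h2 : Tendsto (fun n : ℕ => (n : ℝ) + 1) atTop atTop :=
    tendsto_atTop_add_const_right _ _ tendsto_natCast_atTop_atTop
  filter_upwards [h2.eventually h1, eventually_ge_atTop 1] with n hn hn1
  have hn1' : (1 : ℝ) ≤ n := by exact_mod_cast hn1
  rw [Real.norm_of_nonneg (by positivity), Real.norm_of_nonneg (by positivity),
    inv_mul_eq_div, le_div_iff₀ hC0] at hn
  have hfl : (⌊t * (n : ℝ)⌋₊ : ℝ) ≤ t * n := Nat.floor_le (by positivity)
  calc typePoly X n * ((⌊t * (n : ℝ)⌋₊ : ℝ) + 1) ^ Fintype.card V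
      ≤ typePoly X n * ((t + 1) * ((n : ℝ) + 1)) ^ Fintype.card V := by
        have h0 := zero_le_one.trans (one_le_typePoly X n)
        gcongr
        nlinarith
    _ = ((n : ℝ) + 1) ^ d * C := by
        rw [typePoly, mul_pow, mul_pow, hd, hC, pow_add]
        ring
    _ ≤ Real.exp (γ / 2 * ((n : ℝ) + 1)) := hn
    _ ≤ Real.exp (n * γ) := Real.exp_le_exp.mpr (by nlinarith)

theorem eventually_add_two_mul_rpow_le_exp {K N : ℕ → ℝ} (hK : ∀ n, 1 ≤ K n) (hN : ∀ n, 1 ≤ N n)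
    (hKN : ∀ γ > 0, ∀ᶠ n : ℕ in atTop, K n * N n ≤ Real.exp (n * γ)) {ρ : ℝ} (hρ : 0 ≤ ρ)
    {γ : ℝ} (hγ : 0 < γ) :
    ∀ᶠ n : ℕ in atTop, N n + 2 * ((K n * N n) ^ ρ * N n) ≤ Real.exp (n * γ) := by
  have hγ' : 0 < γ / (2 * (ρ + 1)) := by positivity
  have h3 : ∀ᶠ n : ℕ in atTop, Real.log 3 ≤ n * (γ / 2) :=
    (tendsto_natCast_atTop_atTop.atTop_mul_const (half_pos hγ)).eventually_ge_atTop _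
  filter_upwards [hKN _ hγ', h3] with n h1 h2
  have hNL : N n ≤ K n * N n := le_mul_of_one_le_left (by linarith [hN n]) (hK n)
  have hL1 : 1 ≤ K n * N n := (hN n).trans hNL
  have hL0 : 0 < K n * N n := by linarith
  have h4 : 1 ≤ (K n * N n) ^ ρ := Real.one_le_rpow hL1 hρ
  calc N n + 2 * ((K n * N n) ^ ρ * N n) ≤ 3 * ((K n * N n) ^ ρ * N n) := by
        nlinarith [hN n]
    _ ≤ 3 * ((K n * N n) ^ ρ * (K n * N n)) := by gcongr
    _ = 3 * (K n * N n) ^ (ρ + 1) := by rw [Real.rpow_add hL0, Real.rpow_one]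
    _ ≤ Real.exp (n * (γ / 2)) * Real.exp (n * (γ / (2 * (ρ + 1)))) ^ (ρ + 1) := by
        refine mul_le_mul ?_ (Real.rpow_le_rpow hL0.le h1 (by linarith)) (by positivity)
          (by positivity)
        rwa [← Real.log_le_iff_le_exp (by norm_num)]
    _ = Real.exp (n * γ) := by
        rw [← Real.exp_mul, ← Real.exp_add]
        congr 1
        field_simp
        ring

theorem eventually_mul_exp_le_card_typeClass {X : Type*} [Fintype X] {Q : X → ℝ}
    {Qh : ℕ → X → ℝ} (htype : ∀ n, 0 < n → IsType n (Qh n)) (htend : Tendsto Qh atTop (𝓝 Q))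
    {N : ℕ → ℝ} (hKN : ∀ γ > 0, ∀ᶠ n : ℕ in atTop, typePoly X n * N n ≤ Real.exp (n * γ))
    {h : ℝ} (hh : h < entH Q) :
    ∀ᶠ n : ℕ in atTop, N n * Real.exp (n * h) ≤ (typeClass n (Qh n)).card := by
  obtain ⟨h', hh1, hh2⟩ := exists_between hh
  have h1 : ∀ᶠ n in atTop, h' < entH (Qh n) :=
    ((continuous_entH.tendsto Q).comp htend).eventually_const_lt hh2
  filter_upwards [h1, hKN (h' - h) (by linarith), eventually_gt_atTop 0] with n h2 h3 hn
  have hK : 0 < typePoly X n := zero_lt_one.trans_le (one_le_typePoly X n)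
  refine le_of_mul_le_mul_left ?_ hK
  calc typePoly X n * (N n * Real.exp (n * h)) = typePoly X n * N n * Real.exp (n * h) := by ring
    _ ≤ Real.exp (n * (h' - h)) * Real.exp (n * h) := by gcongr
    _ = Real.exp (n * h') := by
        rw [← Real.exp_add]
        congr 1
        ring
    _ ≤ Real.exp (n * entH (Qh n)) := Real.exp_le_exp.mpr (by gcongr)
    _ ≤ _ := exp_entH_le_card_typeClass hn (htype n hn)

theorem ExpurgatedBound.mono {X Y : Type*} [Fintype X] [Fintype Y] {W : X → Y → ℝ}
    {Q : X → ℝ} {ρ s s' : ℝ} (hρ : 0 < ρ) (hs : s' ≤ s) (h : ExpurgatedBound W Q ρ s) :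
    ExpurgatedBound W Q ρ s' := fun Q' hQ' =>
  (h Q' hQ').trans (Real.exp_le_exp.mpr (neg_le_neg (by gcongr)))

theorem eventually_expurgatedBound {X Y : Type*} [Fintype X] [Fintype Y] {W : X → Y → ℝ}
    (hW : IsDMC W) {Q : X → ℝ} (hQ : IsProbDist Q) {Qh : ℕ → X → ℝ}
    (hle : ∀ ε > 0, ∀ᶠ n in atTop, ∀ x, (1 - ε) * Q x ≤ Qh n x) {ρ s η : ℝ} (hρ : 0 < ρ)
    (hη : 0 < η) (h : ExpurgatedBound W Q ρ s) :
    ∀ᶠ n in atTop, ExpurgatedBound W (Qh n) ρ (s - η) := by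
  have hε : 0 < min 1 (η / (|s| + 1)) := lt_min one_pos (by positivity)
  filter_upwards [hle _ hε] with n hn
  refine (h.of_mul_le hW hQ hρ (min_le_left _ _) hn).mono hρ ?_
  have h1 : min 1 (η / (|s| + 1)) * (|s| + 1) ≤ η := by
    rw [← le_div_iff₀ (by positivity)]
    exact min_le_right _ _
  nlinarith [le_abs_self s]

/-- Sets of sequences that are unions of not too large type classes are not too large. -/
theorem card_le_of_mul_typeSize_le {α : Type*} [Fintype α] {k : ℕ} {N B : ℝ} (hN : 0 < N)
    (hNsum : ∑ v : Fin k → α, ((typeSize v : ℝ))⁻¹ ≤ N) (A : Finset (Fin k → α)) (hB : 0 ≤ B)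
    (h : ∀ v ∈ A, N * typeSize v ≤ B) : (A.card : ℝ) ≤ B := by
  have hM : ∀ v : Fin k → α, (0 : ℝ) < typeSize v := fun v => by exact_mod_cast typeSize_pos v
  calc (A.card : ℝ) = ∑ v ∈ A, 1 := by simp
    _ ≤ ∑ v ∈ A, B / N * ((typeSize v : ℝ))⁻¹ := by
        refine Finset.sum_le_sum fun v hv => ?_
        rw [← div_eq_mul_inv, le_div_iff₀ (hM v), le_div_iff₀ hN]
        linarith [h v hv]
    _ ≤ ∑ v, B / N * ((typeSize v : ℝ))⁻¹ :=
        Finset.sum_le_sum_of_subset_of_nonneg (Finset.subset_univ _) fun v _ _ => by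
          have := hM v
          positivity
    _ ≤ B / N * N := by
        rw [← Finset.mul_sum]
        exact mul_le_mul_of_nonneg_left hNsum (by positivity)
    _ = B := div_mul_cancel₀ _ hN.ne'

end

/-- Achievability of `E^dual_{J,ex}(t, 𝒬ₘ)` by codes built on a partition of `𝒱^k`,
`k = ⌊tn⌋`, into `m` classes of source types with compositions approximating `Q₁, …, Qₘ`;
the partition is admissible as soon as the rate `t log|𝒱|` of all of `𝒱^k` is below
`max_c H(Q_c)`. -/
theorem stmt5 {V X Y : Type*} [Fintype V] [Fintype X] [Fintype Y]
    (PV : V → ℝ) (hPV : IsProbDist PV) (W : X → Y → ℝ) (hW : IsDMC W)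
    (t : ℝ) (ht : 0 < t) (m : ℕ) (hm : 0 < m)
    (Qs : Fin m → X → ℝ) (hQs : ∀ c, IsProbDist (Qs c))
    (E : ℝ) (hE : (E : EReal) < EJexDual PV W t Qs) (δ : ℝ) (hδ : 0 < δ) :
    ∃ n₀ : ℕ, ∀ n : ℕ, n₀ ≤ n →
      ∃ (cls : (Fin ⌊t * (n : ℝ)⌋₊ → V) → Fin m) (Qc : Fin m → X → ℝ),
        TypePartition n cls Qc ∧
        ((∃ c, t * Real.log (Fintype.card V) < entH (Qs c)) → AdmissiblePartition n cls Qc) ∧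
        (∀ c x, |Qc c x - Qs c x| ≤ δ) ∧
        ∃ (f : (Fin ⌊t * (n : ℝ)⌋₊ → V) → Fin n → X)
          (φ : (Fin n → Y) → Fin ⌊t * (n : ℝ)⌋₊ → V),
          (∀ v, f v ∈ typeClass n (Qc (cls v))) ∧
          pErr PV W f φ ≤ Real.exp (-((n : ℝ) * E)) := by
  classical
  unfold EJexDual at hE
  rw [lt_iSup_iff] at hE
  obtain ⟨lam, hE⟩ := hE
  rw [lt_iSup_iff] at hE
  obtain ⟨hlam, hE⟩ := hE
  have hE' : ((E + t * Es PV lam : ℝ) : EReal) < ExBar W Qs lam := by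
    rw [EReal.coe_add]
    exact EReal.add_lt_of_lt_sub hE
  obtain ⟨a, ha1, ha2⟩ := EReal.exists_between_coe_real hE'
  rw [EReal.coe_lt_coe_iff] at ha1
  obtain ⟨η, hη, hηa⟩ : ∃ η : ℝ, 0 < η ∧ a = E + t * Es PV lam + 2 * η :=
    ⟨(a - (E + t * Es PV lam)) / 2, by linarith, by ring⟩
  obtain ⟨F, cF, ρF, sF, hF, hdata, hcover⟩ :=
    exists_finite_exponent_cover hW hQs ha2 (t * Real.log (Fintype.card V))
  choose Qh hQtype hQtend hQle using fun c => exists_type_approx (hQs c)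
  obtain ⟨c₀, hc₀⟩ : ∃ c₀ : Fin m, (∃ c, t * Real.log (Fintype.card V) < entH (Qs c)) →
      t * Real.log (Fintype.card V) < entH (Qs c₀) := by
    by_cases h : ∃ c, t * Real.log (Fintype.card V) < entH (Qs c)
    · exact h.imp fun _ hc _ => hc
    · exact ⟨⟨0, hm⟩, fun h' => absurd h' h⟩
  set N : ℕ → ℝ := fun n => ((⌊t * (n : ℝ)⌋₊ : ℝ) + 1) ^ Fintype.card V with hNdef
  have hN1 : ∀ n, 1 ≤ N n := fun n =>
    one_le_pow₀ (by linarith [Nat.cast_nonneg (α := ℝ) ⌊t * (n : ℝ)⌋₊])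
  have hKN : ∀ γ > 0, ∀ᶠ n : ℕ in atTop, typePoly X n * N n ≤ Real.exp (n * γ) :=
    fun γ hγ => eventually_typePoly_mul_le_exp X V ht hγ
  set ρm : ℝ := ∑ i ∈ F, |ρF i| with hρm
  have hρm0 : 0 ≤ ρm := Finset.sum_nonneg fun _ _ => abs_nonneg _
  have hρle : ∀ i ∈ F, ρF i ≤ ρm := fun i hi => (le_abs_self _).trans
    (Finset.single_le_sum (f := fun i => |ρF i|) (fun _ _ => abs_nonneg _) hi)
  have ev_poly := eventually_add_two_mul_rpow_le_exp (one_le_typePoly X) hN1 hKN hρm0 hη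
  have ev_close : ∀ᶠ n in atTop, ∀ c x, |Qh c n x - Qs c x| ≤ δ := by
    rw [eventually_all]
    intro c
    rw [eventually_all]
    intro x
    have := ((tendsto_pi_nhds.mp (hQtend c)) x).eventually (Metric.closedBall_mem_nhds _ hδ)
    filter_upwards [this] with n hn
    simpa [Real.dist_eq] using hn
  have ev_bound : ∀ᶠ n in atTop, ∀ i ∈ F,
      ExpurgatedBound W (Qh (cF i) n) (ρF i) (sF i - η) := by
    rw [eventually_all_finset]
    intro i hi
    obtain ⟨h1, h2, -⟩ := hdata i hi
    exact eventually_expurgatedBound hW (hQs _) (hQle _) (by linarith) hη h2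
  have ev_card : ∀ᶠ n in atTop, ∀ i ∈ F,
      N n * Real.exp (n * hF i) ≤ (typeClass n (Qh (cF i) n)).card := by
    rw [eventually_all_finset]
    intro i hi
    exact eventually_mul_exp_le_card_typeClass (hQtype _) (hQtend _) hKN (hdata i hi).2.2
  have ev_card₀ : ∀ᶠ n in atTop, (∃ c, t * Real.log (Fintype.card V) < entH (Qs c)) →
      N n * Real.exp (n * (t * Real.log (Fintype.card V))) ≤ (typeClass n (Qh c₀ n)).card := by
    by_cases h : ∃ c, t * Real.log (Fintype.card V) < entH (Qs c)
    · filter_upwards [eventually_mul_exp_le_card_typeClass (hQtype _) (hQtend _) hKN (hc₀ h)]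
        with n hn _ using hn
    · exact Eventually.of_forall fun n h' => absurd h' h
  have hall := (((((eventually_gt_atTop 0).and ev_poly).and ev_close).and ev_bound).and
    ev_card).and ev_card₀
  obtain ⟨n₀, hn₀⟩ := eventually_atTop.mp hall
  refine ⟨n₀, fun n hn => ?_⟩
  obtain ⟨⟨⟨⟨⟨hn0, hpoly⟩, hclose⟩, hbound⟩, hcard⟩, hcard₀⟩ := hn₀ n hn
  clear hall ev_poly ev_close ev_bound ev_card ev_card₀ hn₀
  have hnR : (0 : ℝ) < n := by exact_mod_cast hn0
  set k := ⌊t * (n : ℝ)⌋₊ with hk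
  have hktn : (k : ℝ) ≤ t * n := Nat.floor_le (by positivity)
  have hVne : Nonempty V := by
    by_contra h
    rw [not_nonempty_iff] at h
    have := hPV.2
    simp at this
  have hcardV : (1 : ℝ) ≤ Fintype.card V := by exact_mod_cast Fintype.card_pos
  have hlogV : 0 ≤ Real.log (Fintype.card V) := Real.log_nonneg hcardV
  have hpowV : ((Fintype.card V : ℝ)) ^ k ≤ Real.exp (n * (t * Real.log (Fintype.card V))) := by
    have : ((Fintype.card V : ℝ)) ^ k = Real.exp (k * Real.log (Fintype.card V)) := by
      rw [Real.exp_nat_mul, Real.exp_log (by linarith)]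
    rw [this]
    exact Real.exp_le_exp.mpr (by nlinarith)
  have hM : ∀ v : Fin k → V, (0 : ℝ) < typeSize v := fun v => by exact_mod_cast typeSize_pos v
  have hM1 : ∀ v : Fin k → V, (1 : ℝ) ≤ typeSize v := fun v => by exact_mod_cast typeSize_pos v
  let R : (Fin k → V) → ℝ := fun v => Real.log (typeSize v) / n
  have hMR : ∀ v, (typeSize v : ℝ) = Real.exp (n * R v) := fun v => by
    simp only [R]
    rw [mul_div_cancel₀ _ hnR.ne', Real.exp_log (hM v)]
  have hRmem : ∀ v, R v ∈ Set.Icc 0 (t * Real.log (Fintype.card V)) := by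
    intro v
    refine ⟨div_nonneg (Real.log_nonneg (hM1 v)) hnR.le, ?_⟩
    have h1 : (typeSize v : ℝ) ≤ ((Fintype.card V : ℝ)) ^ k := by
      have : typeSize v ≤ Fintype.card V ^ k :=
        (Finset.card_le_univ _).trans (by simp)
      exact_mod_cast this
    have h2 := h1.trans hpowV
    rw [hMR v, Real.exp_le_exp] at h2
    exact le_of_mul_le_mul_left h2 hnR
  have hsel : ∀ r : ℝ, ∃ i, r ∈ Set.Icc 0 (t * Real.log (Fintype.card V)) →
      i ∈ F ∧ (a < lam * r ∨ (a < sF i + (lam - ρF i) * r ∧ r < hF i)) := by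
    intro r
    by_cases hr : r ∈ Set.Icc 0 (t * Real.log (Fintype.card V))
    · obtain ⟨i, hi, h⟩ := hcover r hr
      exact ⟨i, fun _ => ⟨hi, h⟩⟩
    · exact ⟨0, fun h => absurd h hr⟩
  choose sel hsel using hsel
  let cls : (Fin k → V) → Fin m := fun v =>
    if a < lam * R v then c₀ else cF (sel (R v))
  have hpart : TypePartition n cls fun c => Qh c n := by
    refine ⟨fun v v' h => ?_, fun c => hQtype c n hn0⟩
    have hR : R v = R v' := by simp only [R, typeSize, h]
    simp only [cls, hR]
  have hNsum : ∑ v : Fin k → V, ((typeSize v : ℝ))⁻¹ ≤ N n := sum_inv_typeSize_le k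
  refine ⟨cls, fun c => Qh c n, hpart, fun hex => ⟨hpart, fun c => ?_⟩, hclose, ?_⟩
  · by_cases hc : c = c₀
    · subst hc
      have h1 : (((Finset.univ.filter fun v : Fin k → V => cls v = c).card : ℕ) : ℝ) ≤
          (Fintype.card V : ℝ) ^ k := by
        have : (Finset.univ.filter fun v : Fin k → V => cls v = c).card ≤ Fintype.card V ^ k :=
          (Finset.card_le_univ _).trans (by simp)
        exact_mod_cast this
      have h2 := le_mul_of_one_le_left
        (Real.exp_pos (n * (t * Real.log (Fintype.card V)))).le (hN1 n)
      exact_mod_cast h1.trans (hpowV.trans (h2.trans (hcard₀ hex)))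
    · have h1 := card_le_of_mul_typeSize_le (zero_lt_one.trans_le (hN1 n)) hNsum
        (Finset.univ.filter fun v : Fin k → V => cls v = c)
        (Nat.cast_nonneg (typeClass n (Qh c n)).card) ?_
      · exact_mod_cast h1
      · intro v hv
        have hv' : cls v = c := (Finset.mem_filter.mp hv).2
        have hj : ¬ a < lam * R v := fun hj => hc (by rw [← hv']; simp only [cls, if_pos hj])
        obtain ⟨hi, h2⟩ := hsel (R v) (hRmem v)
        have h3 := (h2.resolve_left hj).2
        have h4 : cF (sel (R v)) = c := by rw [← hv']; simp only [cls, if_neg hj]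
        rw [← h4]
        refine le_trans ?_ (hcard _ hi)
        rw [hMR v]
        have := hN1 n
        gcongr
  · obtain ⟨f, φ, hf, hp⟩ := exists_code_pErr_le (η := Real.exp (-(n * (a - η)))) (ρm := ρm)
      hPV hW hlam
      (Finset.univ.filter fun v : Fin k → V => ¬ a < lam * R v) (fun v => Qh (cls v) n)
      (fun v => hQtype _ n hn0) (fun v => ρF (sel (R v)))
      (fun v => Real.exp (-(n * (sF (sel (R v)) - η) / ρF (sel (R v)))))
      (fun v _ => by
        obtain ⟨hi, -⟩ := hsel (R v) (hRmem v)
        exact ⟨(hdata _ hi).1, hρle _ hi⟩)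
      (fun v _ => Real.exp_pos _) (one_le_typePoly X n) (hN1 n) hNsum (Real.exp_pos _)
      (fun v hv x hx Q' hQ' => by
        obtain ⟨hi, -⟩ := hsel (R v) (hRmem v)
        have hj := (Finset.mem_filter.mp hv).2
        have h4 : cls v = cF (sel (R v)) := by simp only [cls, if_neg hj]
        rw [h4] at hx
        exact sum_typeClass_blockBhat_le W hn0 (hbound _ hi) hQ' hx)
      (fun v hv => by
        obtain ⟨hi, h2⟩ := hsel (R v) (hRmem v)
        have hj := (Finset.mem_filter.mp hv).2
        have h3 := (h2.resolve_left hj).1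
        have hρ1 := (hdata _ hi).1
        rw [hMR v, ← Real.exp_add, ← Real.exp_mul, ← Real.exp_mul, ← Real.exp_add,
          Real.exp_le_exp, add_mul, neg_mul, div_mul_cancel₀ _ (by linarith)]
        nlinarith)
      (fun v hv => by
        have hj : a < lam * R v := by
          by_contra h
          exact hv (Finset.mem_filter.mpr ⟨Finset.mem_univ v, h⟩)
        rw [hMR v, ← Real.exp_mul, ← Real.exp_add]
        refine Real.one_le_exp ?_
        nlinarith)
    refine ⟨f, φ, hf, hp.trans ?_⟩
    have hEs := Es_nonneg hPV (lam := lam) (by linarith)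
    calc Real.exp (k * Es PV lam) * Real.exp (-(n * (a - η))) *
          (N n + 2 * ((typePoly X n * N n) ^ ρm * N n))
        ≤ Real.exp (t * n * Es PV lam) * Real.exp (-(n * (a - η))) * Real.exp (n * η) := by
          refine mul_le_mul ?_ hpoly ?_ (by positivity)
          · gcongr
          · have := hN1 n
            have := one_le_typePoly X n
            positivity
      _ = Real.exp (-((n : ℝ) * E)) := by
          rw [← Real.exp_add, ← Real.exp_add, hηa]
          congr 1
          ring
end

section
/- Let $\mathcal V,\mathcal X,\mathcal Y$ be finite nonempty alphabets, $P_V$ a probability distribution on $\mathcal V$ with product extension $P^k(\mathbf v)=\prod_i P_V(v_i)$, and $W(y|x)$ a stochastic matrix (discrete memoryless channel) with product extension $W^n(\mathbf y|\mathbf x)=\prod_l W(y_l|x_l)$. All logarithms are natural. A joint source-channel code of parameters $(k,n)$ is an encoder $f:\mathcal V^k\to\mathcal X^n$ with a decoder $\varphi:\mathcal Y^n\to\mathcal V^k$; its error probability is $$p_e=\sum_{\mathbf v\in\mathcal V^k}P^k(\mathbf v)\sum_{\mathbf y:\varphi(\mathbf y)\neq\mathbf v}W^n(\mathbf y|f(\mathbf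 v)).$$ Let $\mathcal P_n(\mathcal X)$ be the set of empirical distributions (types) of sequences in $\mathcal X^n$ and $T^n(Q)$ the set of sequences in $\mathcal X^n$ of type $Q$. Put $$E_s(\rho,P_V)=(1+\rho)\log\sum_{v}P_V(v)^{1/(1+\rho)},\qquad d_B(x,\bar x)=-\log\sum_y\sqrt{W(y|x)W(y|\bar x)}\in[0,+\infty],$$ $$E_x(Q,\rho)=\sup_{a:\mathcal X\to\mathbb R}\;-\rho\sum_x Q(x)\log\sum_{\bar x}Q(\bar x)\Big(e^{-d_B(x,\bar x)}e^{a(\bar x)-a(x)}\Big)^{1/\rho},\qquad E_x(\rho)=\max_Q E_x(Q,\rho),$$ where $e^{-\infty}=0$, terms with $Q(x)=0$ are $0$, and the maximum is over all probability distributions $Q$ on $\mathcal X$. For $t>0$ define $$E^{\mathrm{dual}}_{G,\mathrm{ex}}(t)=\sup_{\rho\ge1}\{E_x(\rho)-t\,E_s(\rho,P_V)\}\in(-\infty,+\infty].$$ Then for every transmission rate $t>0$ this exponent is achievable with constant-composition codes: for every $\varepsilon>0$ and all sufficiently large $n$, with $k=\lfloor tn\rfloor$, there exist a composition $Q\in\mathcal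 P_n(\mathcal X)$ and a joint source-channel code of parameters $(k,n)$ with all codewords in $T^n(Q)$ such that $$p_e\le\exp\!\big(-n(E^{\mathrm{dual}}_{G,\mathrm{ex}}(t)-\varepsilon)\big),$$ where the right-hand side is $0$ if $E^{\mathrm{dual}}_{G,\mathrm{ex}}(t)=+\infty$. -/
noncomputable section

namespace JSCC

open scoped Classical

/-- `P` is a probability distribution on the finite alphabet `α`. -/
def IsProbDist {α : Type*} [Fintype α] (P : α → ℝ) : Prop :=
  (∀ a, 0 ≤ P a) ∧ ∑ a, P a = 1

/-- `W` is a discrete memoryless channel (a stochastic matrix, `W x y = W(y|x)`). -/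
def IsDMC {X Y : Type*} [Fintype Y] (W : X → Y → ℝ) : Prop :=
  (∀ x y, 0 ≤ W x y) ∧ ∀ x, ∑ y, W x y = 1

/-- Product extension of a distribution: `P^k(v) = ∏ P(vᵢ)`. -/
def prodDist {α : Type*} (P : α → ℝ) {k : ℕ} (v : Fin k → α) : ℝ := ∏ i, P (v i)

/-- Product extension of a channel: `W^n(y|x) = ∏ W(y_l|x_l)`. -/
def prodChannel {X Y : Type*} (W : X → Y → ℝ) {n : ℕ} (x : Fin n → X) (y : Fin n → Y) : ℝ :=
  ∏ l, W (x l) (y l)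

/-- Empirical distribution (type) of a sequence. -/
def empDist {α : Type*} {n : ℕ} (x : Fin n → α) : α → ℝ :=
  fun a => ((Finset.univ.filter fun i => x i = a).card : ℝ) / n

/-- Type class `T^n(Q)`: sequences of length `n` with empirical distribution `Q`. -/
def typeClass {α : Type*} (n : ℕ) (Q : α → ℝ) : Set (Fin n → α) :=
  {x | empDist x = Q}

/-- `Q ∈ 𝒫ₙ(α)`: `Q` is the type of some sequence of length `n`. -/
def IsType {α : Type*} (n : ℕ) (Q : α → ℝ) : Prop :=
  ∃ x : Fin n → α, empDist x = Q

/-- Gallager's source function `E_s(ρ, P_V)`. -/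
def Es {V : Type*} [Fintype V] (ρ : ℝ) (PV : V → ℝ) : ℝ :=
  (1 + ρ) * Real.log (∑ v, PV v ^ (1 / (1 + ρ)))

/-- Bhattacharyya distance `d_B(x, x') = -log ∑ y, √(W(y|x) W(y|x'))`, with value `+∞` when
the output distributions of `x` and `x'` have disjoint supports. -/
def dB {X Y : Type*} [Fintype Y] (W : X → Y → ℝ) (x x' : X) : EReal :=
  -ENNReal.log (ENNReal.ofReal (∑ y, Real.sqrt (W x y * W x' y)))

/-- The Bhattacharyya coefficient `e^{-d_B(x, x')}`, which is `0` when `d_B(x, x') = +∞`. -/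
def expNegDB {X Y : Type*} [Fintype Y] (W : X → Y → ℝ) (x x' : X) : ℝ :=
  (EReal.exp (-dB W x x')).toReal

theorem expNegDB_eq {X Y : Type*} [Fintype Y] (W : X → Y → ℝ) (x x' : X) :
    expNegDB W x x' = ∑ y, Real.sqrt (W x y * W x' y) := by
  unfold expNegDB dB
  rw [neg_neg, ENNReal.exp_log, ENNReal.toReal_ofReal]
  exact Finset.sum_nonneg fun y _ => Real.sqrt_nonneg _

/-- The function maximized over `a` in `E_x(Q, ρ)`. If `Q x > 0`, the inner sum is positive
(its term `x' = x` is `Q x`); if `Q x = 0`, the outer term is `0`. -/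
def ExObjective {X Y : Type*} [Fintype X] [Fintype Y] (W : X → Y → ℝ) (Q : X → ℝ) (ρ : ℝ)
    (a : X → ℝ) : ℝ :=
  -ρ * ∑ x, Q x * Real.log (∑ x', Q x' *
    (expNegDB W x x' * Real.exp (a x' - a x)) ^ (1 / ρ))

/-- Constant-composition expurgated dual function `E_x(Q, ρ)`, a supremum over all
`a : X → ℝ`. -/
def Ex {X Y : Type*} [Fintype X] [Fintype Y] (W : X → Y → ℝ) (Q : X → ℝ) (ρ : ℝ) : EReal :=
  ⨆ a : X → ℝ, ((ExObjective W Q ρ a : ℝ) : EReal)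

/-- `E_x(ρ) = max_Q E_x(Q, ρ)`, over all probability distributions `Q` on `X`. -/
def ExMax {X Y : Type*} [Fintype X] [Fintype Y] (W : X → Y → ℝ) (ρ : ℝ) : EReal :=
  ⨆ (Q : X → ℝ) (_ : IsProbDist Q), Ex W Q ρ

/-- `E^dual_{G,ex}(t) = sup_{ρ ≥ 1} {E_x(ρ) - t E_s(ρ, P_V)}`. The supremum is taken in the
extended reals: it can be `+∞` for channels with inputs that have disjoint output supports. -/
def EGexDual {V X Y : Type*} [Fintype V] [Fintype X] [Fintype Y]
    (PV : V → ℝ) (W : X → Y → ℝ) (t : ℝ) : EReal :=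
  ⨆ (ρ : ℝ) (_ : 1 ≤ ρ), (ExMax W ρ - ((t * Es ρ PV : ℝ) : EReal))

/-- Error probability of the joint source-channel code with encoder `f` and decoder `φ`. -/
def pErr {V X Y : Type*} [Fintype V] [Fintype Y] (PV : V → ℝ)
    (W : X → Y → ℝ) {k n : ℕ}
    (f : (Fin k → V) → Fin n → X) (φ : (Fin n → Y) → Fin k → V) : ℝ :=
  ∑ v : Fin k → V, prodDist PV v *
    ∑ y ∈ Finset.univ.filter (fun y : Fin n → Y => φ y ≠ v), prodChannel W (f v) y

end JSCC

end

noncomputable section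

namespace JSCC

open scoped Classical

/-- Subadditivity of `x ↦ x ^ (1 / ρ)` on finite sums, in the form `∑ g ≤ (∑ g ^ (1 / ρ)) ^ ρ`. -/
theorem sum_le_rpow_sum_rpow {ι : Type*} (s : Finset ι) (g : ι → ℝ) (hg : ∀ i ∈ s, 0 ≤ g i)
    {ρ : ℝ} (hρ : 1 ≤ ρ) : ∑ i ∈ s, g i ≤ (∑ i ∈ s, g i ^ (1 / ρ)) ^ ρ := by
  have hρ0 : 0 < ρ := by linarith
  have h1 : (∑ i ∈ s, g i) ^ (1 / ρ) ≤ ∑ i ∈ s, g i ^ (1 / ρ) := by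
    refine Finset.le_sum_of_subadditive_on_pred (fun x : ℝ => x ^ (1 / ρ)) (fun x => 0 ≤ x)
      ?_ ?_ ?_ g hg
    · rw [Real.zero_rpow (by positivity)]
    · intro x y hx hy
      exact Real.rpow_add_le_add_rpow hx hy (by positivity) ((div_le_one hρ0).2 hρ)
    · intro x y hx hy
      exact add_nonneg hx hy
  have h0 : 0 ≤ ∑ i ∈ s, g i := Finset.sum_nonneg hg
  calc ∑ i ∈ s, g i = ((∑ i ∈ s, g i) ^ (1 / ρ)) ^ ρ := by
        rw [← Real.rpow_mul h0, one_div_mul_cancel hρ0.ne', Real.rpow_one]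
    _ ≤ _ := Real.rpow_le_rpow (Real.rpow_nonneg h0 _) h1 hρ0.le

/-- If `p` is at most every probability in the sum, the Bhattacharyya-weighted sum is controlled by
Gallager's tilted probabilities. -/
theorem sqrt_mul_rpow_sum_le {S : Type*} (s : Finset S) (P : S → ℝ) {p : ℝ} (hp : 0 ≤ p)
    (hP : ∀ v ∈ s, p ≤ P v) {ρ : ℝ} (hρ : 1 ≤ ρ) :
    √p * (∑ v ∈ s, √(P v) ^ (1 / ρ)) ^ ρ ≤
      p ^ (1 / (1 + ρ)) * (∑ v ∈ s, P v ^ (1 / (1 + ρ))) ^ ρ := by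
  have hρ0 : 0 < ρ := by linarith
  rcases hp.eq_or_lt with rfl | hp
  · simp [Real.zero_rpow (show (1 + ρ)⁻¹ ≠ 0 by positivity)]
  set e : ℝ := 1 / (2 * ρ) - 1 / (1 + ρ) with he
  have he0 : e ≤ 0 := by
    rw [he, sub_nonpos]
    exact one_div_le_one_div_of_le (by linarith) (by linarith)
  have hterm : ∀ v ∈ s, √(P v) ^ (1 / ρ) ≤ P v ^ (1 / (1 + ρ)) * p ^ e := by
    intro v hv
    have hv0 : 0 < P v := hp.trans_le (hP v hv)
    calc √(P v) ^ (1 / ρ) = P v ^ (1 / (1 + ρ)) * P v ^ e := by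
          rw [Real.sqrt_eq_rpow, ← Real.rpow_mul hv0.le, ← Real.rpow_add hv0]
          congr 1
          rw [he]; field_simp; ring
      _ ≤ _ := mul_le_mul_of_nonneg_left
          (Real.rpow_le_rpow_of_nonpos hp (hP v hv) he0)
          (Real.rpow_nonneg hv0.le _)
  have hsum : ∑ v ∈ s, √(P v) ^ (1 / ρ) ≤ (∑ v ∈ s, P v ^ (1 / (1 + ρ))) * p ^ e := by
    rw [Finset.sum_mul]; exact Finset.sum_le_sum hterm
  have hS : 0 ≤ ∑ v ∈ s, P v ^ (1 / (1 + ρ)) :=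
    Finset.sum_nonneg fun v hv => Real.rpow_nonneg (hp.le.trans (hP v hv)) _
  calc √p * (∑ v ∈ s, √(P v) ^ (1 / ρ)) ^ ρ
      ≤ √p * ((∑ v ∈ s, P v ^ (1 / (1 + ρ))) * p ^ e) ^ ρ := by
        refine mul_le_mul_of_nonneg_left (Real.rpow_le_rpow ?_ hsum hρ0.le) (Real.sqrt_nonneg _)
        exact Finset.sum_nonneg fun v _ => Real.rpow_nonneg (Real.sqrt_nonneg _) _
    _ = (p ^ (1 / 2 : ℝ) * p ^ (e * ρ)) * (∑ v ∈ s, P v ^ (1 / (1 + ρ))) ^ ρ := by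
        rw [Real.mul_rpow hS (Real.rpow_nonneg hp.le _), Real.sqrt_eq_rpow, ← Real.rpow_mul hp.le]
        ring
    _ = _ := by
        rw [← Real.rpow_add hp]
        congr 2
        rw [he]; field_simp; ring

/-- Greedy codeword selection: messages are treated in order of decreasing probability, and each
receives a codeword at least as good as the average over `T`. -/
theorem exists_code_pairwise_le {S Z : Type*} [Fintype S] [DecidableEq S] (T : Finset Z)
    (hT : T.Nonempty) (P : S → ℝ) (hP : ∀ v, 0 ≤ P v) (B : Z → Z → ℝ) (hB : ∀ z z', 0 ≤ B z z')
    (hBs : ∀ z z', B z z' = B z' z) {ρ : ℝ} (hρ : 1 ≤ ρ) {A : ℝ} (hA0 : 0 ≤ A)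
    (hA : ∀ z' ∈ T, ∑ z ∈ T, B z z' ^ (1 / ρ) ≤ T.card * A) :
    ∃ f : S → Z, (∀ v, f v ∈ T) ∧
      ∑ v, ∑ v', (if v = v' then 0 else √(P v) * √(P v') * B (f v) (f v')) ≤
        2 * (∑ v, P v ^ (1 / (1 + ρ))) ^ (1 + ρ) * A ^ ρ := by
  have hρ0 : 0 < ρ := by linarith
  set qtot : ℝ := ∑ v, P v ^ (1 / (1 + ρ)) with hqt
  have hq : ∀ v, 0 ≤ P v ^ (1 / (1 + ρ)) := fun v => Real.rpow_nonneg (hP v) _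
  have hqt0 : 0 ≤ qtot := Finset.sum_nonneg fun v _ => hq v
  obtain ⟨z₀, hz₀⟩ := hT
  have key : ∃ f : S → Z, (∀ v, f v ∈ T) ∧
      ∑ v ∈ Finset.univ, ∑ v' ∈ Finset.univ,
        (if v = v' then 0 else √(P v) * √(P v') * B (f v) (f v')) ≤
        2 * ((∑ v ∈ Finset.univ, P v ^ (1 / (1 + ρ))) * qtot ^ ρ) * A ^ ρ := by
    refine Finset.induction_on_min_value (motive := fun s => ∃ f : S → Z, (∀ v, f v ∈ T) ∧
      ∑ v ∈ s, ∑ v' ∈ s, (if v = v' then 0 else √(P v) * √(P v') * B (f v) (f v')) ≤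
        2 * ((∑ v ∈ s, P v ^ (1 / (1 + ρ))) * qtot ^ ρ) * A ^ ρ) P Finset.univ ?_ ?_
    · exact ⟨fun _ => z₀, fun _ => hz₀, by simp⟩
    · rintro a s has hmin ⟨f, hfT, hf⟩
      set w : ℝ := ∑ v ∈ s, √(P v) ^ (1 / ρ) with hw
      have hw0 : 0 ≤ w := Finset.sum_nonneg fun v _ => Real.rpow_nonneg (Real.sqrt_nonneg _) _
      obtain ⟨z, hz, hzle⟩ : ∃ z ∈ T, ∑ v ∈ s, (√(P v) * B z (f v)) ^ (1 / ρ) ≤ w * A := by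
        refine Finset.exists_le_of_sum_le ⟨z₀, hz₀⟩ ?_
        rw [Finset.sum_comm, Finset.sum_const, nsmul_eq_mul]
        calc ∑ v ∈ s, ∑ z ∈ T, (√(P v) * B z (f v)) ^ (1 / ρ)
            = ∑ v ∈ s, √(P v) ^ (1 / ρ) * ∑ z ∈ T, B z (f v) ^ (1 / ρ) := by
              refine Finset.sum_congr rfl fun v _ => ?_
              rw [Finset.mul_sum]
              exact Finset.sum_congr rfl fun z _ =>
                Real.mul_rpow (Real.sqrt_nonneg _) (hB _ _)
          _ ≤ ∑ v ∈ s, √(P v) ^ (1 / ρ) * (T.card * A) :=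
              Finset.sum_le_sum fun v _ => mul_le_mul_of_nonneg_left (hA _ (hfT v))
                (Real.rpow_nonneg (Real.sqrt_nonneg _) _)
          _ = T.card * (w * A) := by rw [← Finset.sum_mul]; ring
      have hz2 : √(P a) * ∑ v ∈ s, √(P v) * B z (f v) ≤
          P a ^ (1 / (1 + ρ)) * qtot ^ ρ * A ^ ρ := by
        calc √(P a) * ∑ v ∈ s, √(P v) * B z (f v)
            ≤ √(P a) * (w * A) ^ ρ := by
              refine mul_le_mul_of_nonneg_left ?_ (Real.sqrt_nonneg _)
              refine (sum_le_rpow_sum_rpow s _ (fun v _ =>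
                mul_nonneg (Real.sqrt_nonneg _) (hB _ _)) hρ).trans ?_
              exact Real.rpow_le_rpow (Finset.sum_nonneg fun v _ => Real.rpow_nonneg
                (mul_nonneg (Real.sqrt_nonneg _) (hB _ _)) _) hzle hρ0.le
          _ = √(P a) * w ^ ρ * A ^ ρ := by rw [Real.mul_rpow hw0 hA0]; ring
          _ ≤ P a ^ (1 / (1 + ρ)) * (∑ v ∈ s, P v ^ (1 / (1 + ρ))) ^ ρ * A ^ ρ :=
              mul_le_mul_of_nonneg_right (sqrt_mul_rpow_sum_le s P (hP a) hmin hρ)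
                (Real.rpow_nonneg hA0 _)
          _ ≤ _ := by
              refine mul_le_mul_of_nonneg_right (mul_le_mul_of_nonneg_left ?_ (hq a))
                (Real.rpow_nonneg hA0 _)
              exact Real.rpow_le_rpow (Finset.sum_nonneg fun v _ => hq v)
                (Finset.sum_le_sum_of_subset_of_nonneg (Finset.subset_univ s)
                  fun v _ _ => hq v) hρ0.le
      refine ⟨Function.update f a z, fun v => ?_, ?_⟩
      · by_cases hv : v = a
        · subst hv; simpa using hz
        · simpa [hv] using hfT v
      · have hne : ∀ v ∈ s, v ≠ a := fun v hv h => has (h ▸ hv)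
        have hrow : ∑ v' ∈ s, (if a = v' then 0 else √(P a) * √(P v') *
            B (Function.update f a z a) (Function.update f a z v')) =
            √(P a) * ∑ v ∈ s, √(P v) * B z (f v) := by
          rw [Finset.mul_sum]
          refine Finset.sum_congr rfl fun v hv => ?_
          rw [if_neg (hne v hv).symm, Function.update_self, Function.update_of_ne (hne v hv)]
          ring
        have hcol : ∑ v ∈ s, (if v = a then 0 else √(P v) * √(P a) *
            B (Function.update f a z v) (Function.update f a z a)) =
            √(P a) * ∑ v ∈ s, √(P v) * B z (f v) := by
          rw [Finset.mul_sum]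
          refine Finset.sum_congr rfl fun v hv => ?_
          rw [if_neg (hne v hv), Function.update_self, Function.update_of_ne (hne v hv), hBs]
          ring
        have hold : ∑ v ∈ s, ∑ v' ∈ s, (if v = v' then 0 else √(P v) * √(P v') *
            B (Function.update f a z v) (Function.update f a z v')) =
            ∑ v ∈ s, ∑ v' ∈ s, (if v = v' then 0 else √(P v) * √(P v') * B (f v) (f v')) := by
          refine Finset.sum_congr rfl fun v hv => Finset.sum_congr rfl fun v' hv' => ?_
          rw [Function.update_of_ne (hne v hv), Function.update_of_ne (hne v' hv')]
        rw [Finset.sum_insert has, Finset.sum_insert has, if_pos rfl, hrow,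
          Finset.sum_congr rfl fun v _ => Finset.sum_insert has, Finset.sum_add_distrib, hcol,
          hold, Finset.sum_insert has]
        linarith
  obtain ⟨f, hfT, hf⟩ := key
  refine ⟨f, hfT, hf.trans_eq ?_⟩
  rcases hqt0.eq_or_lt with h | h
  · rw [← hqt, ← h, Real.zero_rpow (show 1 + ρ ≠ 0 by linarith)]; ring
  · rw [← hqt, Real.rpow_add h, Real.rpow_one]

/-- A maximum a posteriori decoder meets the pairwise Bhattacharyya bound. -/
theorem exists_decoder_pErr_le {V X Y : Type*} [Fintype V] [Fintype Y] [Nonempty V]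
    (PV : V → ℝ) (hPV : ∀ v, 0 ≤ PV v) (W : X → Y → ℝ) (hW : ∀ x y, 0 ≤ W x y) {k n : ℕ}
    (f : (Fin k → V) → Fin n → X) :
    ∃ φ : (Fin n → Y) → Fin k → V, pErr PV W f φ ≤
      ∑ v, ∑ v', (if v = v' then 0 else √(prodDist PV v) * √(prodDist PV v') *
        ∏ l, expNegDB W (f v l) (f v' l)) := by
  have hP : ∀ v : Fin k → V, 0 ≤ prodDist PV v := fun v => Finset.prod_nonneg fun i _ => hPV _
  have hWn : ∀ (x : Fin n → X) (y : Fin n → Y), 0 ≤ prodChannel W x y :=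
    fun x y => Finset.prod_nonneg fun i _ => hW _ _
  have hmax : ∀ y : Fin n → Y, ∃ v : Fin k → V, ∀ v',
      prodDist PV v' * prodChannel W (f v') y ≤ prodDist PV v * prodChannel W (f v) y :=
    fun y => Finite.exists_max _
  choose φ hφ using hmax
  refine ⟨φ, ?_⟩
  have hB : ∀ x x' : Fin n → X, ∏ l, expNegDB W (x l) (x' l) =
      ∑ y : Fin n → Y, √(prodChannel W x y) * √(prodChannel W x' y) := by
    intro x x'
    simp_rw [expNegDB_eq]
    rw [Finset.prod_univ_sum, Fintype.piFinset_univ]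
    refine Finset.sum_congr rfl fun y _ => ?_
    rw [← Real.sqrt_mul (hWn _ _), prodChannel, prodChannel, ← Finset.prod_mul_distrib,
      Real.sqrt_prod _ fun i _ => mul_nonneg (hW _ _) (hW _ _)]
  have hR : ∑ v, ∑ v', (if v = v' then 0 else √(prodDist PV v) * √(prodDist PV v') *
        ∏ l, expNegDB W (f v l) (f v' l)) = ∑ v, ∑ y : Fin n → Y, ∑ v',
        (if v = v' then 0 else √(prodDist PV v * prodChannel W (f v) y) *
          √(prodDist PV v' * prodChannel W (f v') y)) := by
    refine Finset.sum_congr rfl fun v _ => ?_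
    rw [Finset.sum_comm]
    refine Finset.sum_congr rfl fun v' _ => ?_
    split_ifs with h
    · simp
    · rw [hB, Finset.mul_sum]
      refine Finset.sum_congr rfl fun y _ => ?_
      rw [Real.sqrt_mul (hP v), Real.sqrt_mul (hP v')]
      ring
  rw [hR, pErr]
  refine Finset.sum_le_sum fun v _ => ?_
  rw [Finset.mul_sum, Finset.sum_filter]
  refine Finset.sum_le_sum fun y _ => ?_
  have hnn : ∀ v', 0 ≤ (if v = v' then 0 else √(prodDist PV v * prodChannel W (f v) y) *
          √(prodDist PV v' * prodChannel W (f v') y)) := by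
    intro v'; split_ifs <;> positivity
  split_ifs with h
  · refine le_trans ?_ (Finset.single_le_sum (fun v' _ => hnn v') (Finset.mem_univ (φ y)))
    rw [if_neg (Ne.symm h)]
    calc prodDist PV v * prodChannel W (f v) y
        = √(prodDist PV v * prodChannel W (f v) y) * √(prodDist PV v * prodChannel W (f v) y) :=
          (Real.mul_self_sqrt (mul_nonneg (hP _) (hWn _ _))).symm
      _ ≤ _ := mul_le_mul_of_nonneg_left (Real.sqrt_le_sqrt (hφ y v)) (Real.sqrt_nonneg _)
  · exact Finset.sum_nonneg fun v' _ => hnn v'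

theorem sum_prodDist_mul_prod {X : Type*} [Fintype X] (Q g : X → ℝ) (n : ℕ) :
    ∑ x : Fin n → X, prodDist Q x * ∏ l, g (x l) = (∑ x, Q x * g x) ^ n := by
  rw [Fintype.sum_pow]
  exact Finset.sum_congr rfl fun x _ => by rw [prodDist, Finset.prod_mul_distrib]

theorem sum_prodDist {X : Type*} [Fintype X] {Q : X → ℝ} (hQ : IsProbDist Q) (n : ℕ) :
    ∑ x : Fin n → X, prodDist Q x = 1 := by
  simpa [hQ.2] using sum_prodDist_mul_prod Q (fun _ => 1) n

theorem prodDist_nonneg {X : Type*} [Fintype X] {Q : X → ℝ} (hQ : IsProbDist Q) {n : ℕ}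
    (x : Fin n → X) : 0 ≤ prodDist Q x := Finset.prod_nonneg fun _ _ => hQ.1 _

/-- Strict decrease of the moment generating function of a centred variable shifted by `-δ`. -/
theorem exists_mgf_le {X : Type*} [Fintype X] {Q : X → ℝ} (hQ : IsProbDist Q) (h : X → ℝ)
    {δ : ℝ} (hδ : 0 < δ) :
    ∃ s > 0, ∃ r < 1, 0 ≤ r ∧
      ∑ x, Q x * Real.exp (s * (h x - (∑ x, Q x * h x + δ))) ≤ r := by
  set μ := ∑ x, Q x * h x with hμ
  set M := δ + ∑ x, |h x - μ| with hM
  have hsum0 : 0 ≤ ∑ x, |h x - μ| := Finset.sum_nonneg fun x _ => abs_nonneg _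
  have hM0 : 0 < M := by linarith
  have hMb : ∀ x, |h x - μ| ≤ M := fun x => by
    have := Finset.single_le_sum (f := fun x => |h x - μ|) (fun x _ => abs_nonneg _)
      (Finset.mem_univ x)
    linarith
  set s := δ / (2 * M ^ 2) with hs
  have hs0 : 0 < s := by positivity
  have hsM : s * M ≤ 1 := by
    have : s * M = δ / (2 * M) := by rw [hs]; field_simp
    rw [this, div_le_one (by positivity)]; linarith
  have hsM2 : s ^ 2 * M ^ 2 = s * δ / 2 := by rw [hs]; field_simp
  refine ⟨s, hs0, Real.exp (-(s * δ / 2)), ?_, (Real.exp_pos _).le, ?_⟩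
  · rw [Real.exp_lt_one_iff]; have := mul_pos hs0 hδ; linarith
  · have hterm : ∀ x, Q x * Real.exp (s * (h x - (μ + δ))) ≤
        Real.exp (-(s * δ)) * (Q x * (1 + s * δ / 2) + s * (Q x * h x - Q x * μ)) := by
      intro x
      have hu : |s * (h x - μ)| ≤ 1 := by
        rw [abs_mul, abs_of_pos hs0]
        exact (mul_le_mul_of_nonneg_left (hMb x) hs0.le).trans hsM
      have h1 := (abs_le.1 (Real.abs_exp_sub_one_sub_id_le hu)).2
      have h2 : (s * (h x - μ)) ^ 2 ≤ s * δ / 2 := by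
        rw [mul_pow, ← hsM2]
        refine mul_le_mul_of_nonneg_left ?_ (by positivity)
        rw [← sq_abs]
        exact pow_le_pow_left₀ (abs_nonneg _) (hMb x) 2
      have h3 : Real.exp (s * (h x - (μ + δ))) =
          Real.exp (-(s * δ)) * Real.exp (s * (h x - μ)) := by
        rw [← Real.exp_add]; ring_nf
      rw [h3]
      have h4 : Q x * Real.exp (s * (h x - μ)) ≤ Q x * (1 + s * (h x - μ) + s * δ / 2) :=
        mul_le_mul_of_nonneg_left (by linarith) (hQ.1 x)
      have := mul_le_mul_of_nonneg_left h4 (Real.exp_pos (-(s * δ))).le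
      nlinarith [this]
    refine (Finset.sum_le_sum fun x _ => hterm x).trans ?_
    rw [← Finset.mul_sum, Finset.sum_add_distrib, ← Finset.sum_mul, ← Finset.mul_sum,
      Finset.sum_sub_distrib, ← Finset.sum_mul, hQ.2, ← hμ]
    have h5 : 1 + s * δ / 2 ≤ Real.exp (s * δ / 2) := by
      linarith [Real.add_one_le_exp (s * δ / 2)]
    calc Real.exp (-(s * δ)) * (1 * (1 + s * δ / 2) + s * (μ - 1 * μ))
        ≤ Real.exp (-(s * δ)) * Real.exp (s * δ / 2) := by
          refine mul_le_mul_of_nonneg_left ?_ (Real.exp_pos _).le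
          linarith
      _ = _ := by rw [← Real.exp_add]; ring_nf

/-- One-sided weak law of large numbers for `Q^n`. -/
theorem eventually_half_le_prob {X : Type*} [Fintype X] {Q : X → ℝ} (hQ : IsProbDist Q)
    (h : X → ℝ) {δ : ℝ} (hδ : 0 < δ) :
    ∀ᶠ n : ℕ in Filter.atTop, (1 / 2 : ℝ) ≤ ∑ x : Fin n → X with
      ∑ l, h (x l) ≤ n * (∑ x, Q x * h x + δ), prodDist Q x := by
  obtain ⟨s, hs, r, hr1, hr0, hr⟩ := exists_mgf_le hQ h hδ
  set m := ∑ x, Q x * h x + δ with hm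
  have hlim := (tendsto_pow_atTop_nhds_zero_of_lt_one hr0 hr1).eventually_le_const
    (show (0 : ℝ) < 1 / 2 by norm_num)
  filter_upwards [hlim] with n hn
  have hbad : ∑ x : Fin n → X with ¬ ∑ l, h (x l) ≤ n * m, prodDist Q x ≤ r ^ n := by
    calc ∑ x : Fin n → X with ¬ ∑ l, h (x l) ≤ n * m, prodDist Q x
        ≤ ∑ x : Fin n → X with ¬ ∑ l, h (x l) ≤ n * m,
            prodDist Q x * ∏ l, Real.exp (s * (h (x l) - m)) := by
          refine Finset.sum_le_sum fun x hx => le_mul_of_one_le_right (prodDist_nonneg hQ x) ?_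
          rw [← Real.exp_sum, Real.one_le_exp_iff, ← Finset.mul_sum, Finset.sum_sub_distrib]
          refine mul_nonneg hs.le ?_
          have := (Finset.mem_filter.1 hx).2
          simp only [Finset.sum_const, Finset.card_univ, Fintype.card_fin, nsmul_eq_mul]
          linarith
      _ ≤ ∑ x : Fin n → X, prodDist Q x * ∏ l, Real.exp (s * (h (x l) - m)) :=
          Finset.sum_le_sum_of_subset_of_nonneg (Finset.filter_subset _ _) fun x _ _ =>
            mul_nonneg (prodDist_nonneg hQ x) (Finset.prod_nonneg fun _ _ => (Real.exp_pos _).le)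
      _ ≤ r ^ n := by
          rw [sum_prodDist_mul_prod Q (fun x => Real.exp (s * (h x - m)))]
          exact pow_le_pow_left₀ (Finset.sum_nonneg fun x _ =>
            mul_nonneg (hQ.1 x) (Real.exp_pos _).le) hr n
  have htot := Finset.sum_filter_add_sum_filter_not (Finset.univ : Finset (Fin n → X))
    (fun x => ∑ l, h (x l) ≤ n * m) (prodDist Q)
  rw [sum_prodDist hQ] at htot
  linarith

/-- Products of a letter function depend only on the type of the sequence. -/
theorem prod_eq_of_empDist_eq {X : Type*} [Fintype X] {n : ℕ} {x z : Fin n → X}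
    (hxz : empDist x = empDist z) (g : X → ℝ) : ∏ l, g (x l) = ∏ l, g (z l) := by
  have hcard : ∀ a, (Finset.univ.filter fun i => x i = a).card =
      (Finset.univ.filter fun i => z i = a).card := by
    intro a
    have h := congrFun hxz a
    rcases Nat.eq_zero_or_pos n with rfl | hn
    · simp
    · have hn' : (n : ℝ) ≠ 0 := by positivity
      simp only [empDist] at h
      exact_mod_cast (div_left_inj' hn').1 h
  have hprod : ∀ u : Fin n → X, ∏ l, g (u l) =
      ∏ a, g a ^ (Finset.univ.filter fun i => u i = a).card := by
    intro u
    rw [← Finset.prod_fiberwise' Finset.univ u g]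
    simp
  rw [hprod, hprod]
  exact Finset.prod_congr rfl fun a _ => by rw [hcard]

/-- There is a type whose `Q^n`-probability is only polynomially small and for which the empirical
mean of `h` is at most its `Q`-mean plus `δ`. -/
theorem eventually_exists_type {X : Type*} [Fintype X] {Q : X → ℝ} (hQ : IsProbDist Q)
    (h : X → ℝ) {δ : ℝ} (hδ : 0 < δ) :
    ∀ᶠ n : ℕ in Filter.atTop, ∃ x₀ : Fin n → X, 0 < prodDist Q x₀ ∧
      ∑ l, h (x₀ l) ≤ n * (∑ x, Q x * h x + δ) ∧
      1 / (2 * ((n : ℝ) + 1) ^ Fintype.card X) ≤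
        ∑ x : Fin n → X with empDist x = empDist x₀, prodDist Q x := by
  filter_upwards [eventually_half_le_prob hQ h hδ] with n hn
  have hlt : ∀ (x : Fin n → X) (a : X),
      (Finset.univ.filter fun i => x i = a).card < n + 1 := fun x a =>
    Nat.lt_succ_of_le ((Finset.card_le_univ _).trans_eq (Fintype.card_fin n))
  set c : (Fin n → X) → X → Fin (n + 1) := fun x a => ⟨_, hlt x a⟩ with hc
  set b : ℝ := 1 / (2 * ((n : ℝ) + 1) ^ Fintype.card X) with hb
  have hb0 : 0 < b := by positivity
  obtain ⟨y, -, hy⟩ := Finset.exists_le_sum_fiber_of_maps_to_of_nsmul_le_sum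
    (s := Finset.univ.filter fun x : Fin n → X =>
      ∑ l, h (x l) ≤ n * (∑ x, Q x * h x + δ)) (t := Finset.univ) (f := c) (w := prodDist Q)
    (b := b) (fun _ _ => Finset.mem_univ _) Finset.univ_nonempty (by
      refine le_trans (le_of_eq ?_) hn
      rw [Finset.card_univ, Fintype.card_fun, Fintype.card_fin, nsmul_eq_mul, hb]
      push_cast
      field_simp)
  obtain ⟨x₀, hx₀, hpos⟩ := Finset.exists_lt_of_sum_lt (s := Finset.filter (fun x => c x = y)
    (Finset.univ.filter fun x : Fin n → X => ∑ l, h (x l) ≤ n * (∑ x, Q x * h x + δ)))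
    (f := fun _ => (0 : ℝ)) (g := prodDist Q) (by simpa using hb0.trans_le hy)
  simp only [Finset.mem_filter, Finset.mem_univ, true_and] at hx₀
  refine ⟨x₀, hpos, hx₀.1, hy.trans ?_⟩
  refine Finset.sum_le_sum_of_subset_of_nonneg ?_ fun x _ _ => prodDist_nonneg hQ x
  intro x hx
  simp only [Finset.mem_filter, Finset.mem_univ, true_and] at hx ⊢
  have hcx : c x = c x₀ := hx.2.trans hx₀.2.symm
  funext a
  have := congrArg Fin.val (congrFun hcx a)
  simp only [hc] at this
  rw [empDist, empDist, this]

theorem expNegDB_nonneg {X Y : Type*} [Fintype Y] (W : X → Y → ℝ) (x x' : X) :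
    0 ≤ expNegDB W x x' := ENNReal.toReal_nonneg

theorem expNegDB_comm {X Y : Type*} [Fintype Y] (W : X → Y → ℝ) (x x' : X) :
    expNegDB W x x' = expNegDB W x' x := by
  simp_rw [expNegDB_eq, mul_comm]

theorem expNegDB_self {X Y : Type*} [Fintype Y] {W : X → Y → ℝ} (hW : IsDMC W) (x : X) :
    expNegDB W x x = 1 := by
  rw [expNegDB_eq, ← hW.2 x]
  exact Finset.sum_congr rfl fun y _ => Real.sqrt_mul_self (hW.1 x y)

/-- The inner sum of `ExObjective`. -/
def exInner {X Y : Type*} [Fintype X] [Fintype Y] (W : X → Y → ℝ) (Q : X → ℝ) (ρ : ℝ)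
    (a : X → ℝ) (x : X) : ℝ :=
  ∑ x', Q x' * (expNegDB W x x' * Real.exp (a x' - a x)) ^ (1 / ρ)

theorem exInner_pos {X Y : Type*} [Fintype X] [Fintype Y] {W : X → Y → ℝ} (hW : IsDMC W)
    {Q : X → ℝ} (hQ : IsProbDist Q) (ρ : ℝ) (a : X → ℝ) {x : X} (hx : 0 < Q x) :
    0 < exInner W Q ρ a x := by
  have h := Finset.single_le_sum (s := Finset.univ)
    (f := fun x' => Q x' * (expNegDB W x x' * Real.exp (a x' - a x)) ^ (1 / ρ))
    (fun x' _ => mul_nonneg (hQ.1 x') (Real.rpow_nonneg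
      (mul_nonneg (expNegDB_nonneg W x x') (Real.exp_pos _).le) _)) (Finset.mem_univ x)
  simp only [expNegDB_self hW, sub_self, Real.exp_zero, mul_one, Real.one_rpow] at h
  exact hx.trans_le h

/-- Bound on the type-class average of the tilted Bhattacharyya coefficient; the tilting by `a`
cancels because all sequences have the same type. -/
theorem sum_typeClass_rpow_le {X Y : Type*} [Fintype X] [Fintype Y] {W : X → Y → ℝ}
    (hW : IsDMC W) {Q : X → ℝ} (hQ : IsProbDist Q) (ρ : ℝ) (a : X → ℝ) {n : ℕ}
    {x₀ z' : Fin n → X} (hx₀ : 0 < prodDist Q x₀) (hz' : empDist z' = empDist x₀) {b : ℝ}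
    (hb : 0 < b) (hbT : b ≤ ∑ x : Fin n → X with empDist x = empDist x₀, prodDist Q x) :
    ∑ z : Fin n → X with empDist z = empDist x₀, (∏ l, expNegDB W (z l) (z' l)) ^ (1 / ρ) ≤
      ((Finset.univ.filter fun z : Fin n → X => empDist z = empDist x₀).card : ℝ) *
        (b⁻¹ * Real.exp (∑ l, Real.log (exInner W Q ρ a (x₀ l)))) := by
  set T := Finset.univ.filter fun z : Fin n → X => empDist z = empDist x₀ with hT
  set c := prodDist Q x₀ with hc
  have hcT : ∀ z ∈ T, prodDist Q z = c := fun z hz =>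
    prod_eq_of_empDist_eq (Finset.mem_filter.1 hz).2 Q
  set g : X → X → ℝ := fun x x' => (expNegDB W x x' * Real.exp (a x' - a x)) ^ (1 / ρ) with hg
  have hg0 : ∀ x x', 0 ≤ g x x' := fun x x' =>
    Real.rpow_nonneg (mul_nonneg (expNegDB_nonneg W x x') (Real.exp_pos _).le) _
  have htilt : ∀ z ∈ T, (∏ l, expNegDB W (z l) (z' l)) ^ (1 / ρ) = ∏ l, g (z' l) (z l) := by
    intro z hz
    have hz2 : empDist z = empDist z' := (Finset.mem_filter.1 hz).2.trans hz'.symm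
    have h1 := prod_eq_of_empDist_eq hz2 fun x => Real.exp (a x)
    have h2 : ∏ l, Real.exp (a (z l) - a (z' l)) = 1 := by
      simp_rw [Real.exp_sub]
      rw [Finset.prod_div_distrib, h1]
      exact div_self (Finset.prod_pos fun l _ => Real.exp_pos _).ne'
    rw [hg, Real.finsetProd_rpow _ _ fun l _ =>
      mul_nonneg (expNegDB_nonneg W _ _) (Real.exp_pos _).le, Finset.prod_mul_distrib, h2, mul_one]
    simp_rw [expNegDB_comm W (z _)]
  have hsupp : ∀ l, 0 < Q (z' l) := by
    intro l
    refine (hQ.1 _).lt_of_ne fun h => ?_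
    have : prodDist Q z' = 0 := Finset.prod_eq_zero (Finset.mem_univ l) h.symm
    have h2 : prodDist Q z' = c := prod_eq_of_empDist_eq hz' Q
    exact hx₀.ne' (h2.symm.trans this)
  have hexp : ∏ l, exInner W Q ρ a (z' l) =
      Real.exp (∑ l, Real.log (exInner W Q ρ a (x₀ l))) := by
    rw [Real.exp_sum, ← prod_eq_of_empDist_eq hz' fun x => Real.exp (Real.log (exInner W Q ρ a x))]
    exact Finset.prod_congr rfl fun l _ =>
      (Real.exp_log (exInner_pos hW hQ ρ a (hsupp l))).symm
  have hmain : c * ∑ z ∈ T, (∏ l, expNegDB W (z l) (z' l)) ^ (1 / ρ) ≤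
      Real.exp (∑ l, Real.log (exInner W Q ρ a (x₀ l))) := by
    calc c * ∑ z ∈ T, (∏ l, expNegDB W (z l) (z' l)) ^ (1 / ρ)
        = ∑ z ∈ T, ∏ l, Q (z l) * g (z' l) (z l) := by
          rw [Finset.mul_sum]
          refine Finset.sum_congr rfl fun z hz => ?_
          rw [htilt z hz, Finset.prod_mul_distrib, ← hcT z hz, prodDist]
      _ ≤ ∑ z : Fin n → X, ∏ l, Q (z l) * g (z' l) (z l) :=
          Finset.sum_le_sum_of_subset_of_nonneg (Finset.filter_subset _ _) fun z _ _ =>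
            Finset.prod_nonneg fun l _ => mul_nonneg (hQ.1 _) (hg0 _ _)
      _ = ∏ l, exInner W Q ρ a (z' l) := by
          simp_rw [exInner]
          rw [Finset.prod_univ_sum, Fintype.piFinset_univ]
      _ = _ := hexp
  have hbc : b ≤ T.card * c := by
    rwa [Finset.sum_congr rfl hcT, Finset.sum_const, nsmul_eq_mul] at hbT
  set E := Real.exp (∑ l, Real.log (exInner W Q ρ a (x₀ l))) with hE
  set U := ∑ z ∈ T, (∏ l, expNegDB W (z l) (z' l)) ^ (1 / ρ) with hU
  have hU0 : 0 ≤ U := Finset.sum_nonneg fun z _ => Real.rpow_nonneg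
    (Finset.prod_nonneg fun l _ => expNegDB_nonneg W _ _) _
  rw [mul_left_comm, inv_mul_eq_div, le_div_iff₀ hb]
  calc U * b ≤ U * (T.card * c) := mul_le_mul_of_nonneg_left hbc hU0
    _ = T.card * (c * U) := by ring
    _ ≤ T.card * E := mul_le_mul_of_nonneg_left hmain (Nat.cast_nonneg _)

theorem one_le_sum_rpow {V : Type*} [Fintype V] {PV : V → ℝ} (hPV : IsProbDist PV) {ρ : ℝ}
    (hρ : 0 ≤ ρ) : 1 ≤ ∑ v, PV v ^ (1 / (1 + ρ)) := by
  refine hPV.2.symm.le.trans (Finset.sum_le_sum fun v _ => ?_)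
  have h1 : PV v ≤ 1 := by
    rw [← hPV.2]
    exact Finset.single_le_sum (fun v _ => hPV.1 v) (Finset.mem_univ v)
  exact Real.self_le_rpow_of_le_one (hPV.1 v) h1
    ((div_le_one (by linarith)).2 (by linarith))

theorem Es_nonneg {V : Type*} [Fintype V] {PV : V → ℝ} (hPV : IsProbDist PV) {ρ : ℝ}
    (hρ : 0 ≤ ρ) : 0 ≤ Es ρ PV :=
  mul_nonneg (by linarith) (Real.log_nonneg (one_le_sum_rpow hPV hρ))

/-- `E_s` is additive over the memoryless extension of the source. -/
theorem sum_prodDist_rpow_rpow {V : Type*} [Fintype V] {PV : V → ℝ} (hPV : IsProbDist PV) {ρ : ℝ}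
    (hρ : 0 ≤ ρ) (k : ℕ) :
    (∑ v : Fin k → V, prodDist PV v ^ (1 / (1 + ρ))) ^ (1 + ρ) = Real.exp (k * Es ρ PV) := by
  have h1 : ∑ v : Fin k → V, prodDist PV v ^ (1 / (1 + ρ)) =
      (∑ v, PV v ^ (1 / (1 + ρ))) ^ k := by
    rw [Fintype.sum_pow]
    exact Finset.sum_congr rfl fun v _ => (Real.finsetProd_rpow _ _ (fun i _ => hPV.1 _) _).symm
  have hS : 0 < ∑ v, PV v ^ (1 / (1 + ρ)) := zero_lt_one.trans_le (one_le_sum_rpow hPV hρ)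
  rw [h1, Real.rpow_def_of_pos (pow_pos hS k), Real.log_pow, Es]
  ring_nf

theorem eventually_add_mul_log_le (C D : ℝ) (hD : 0 ≤ D) {η : ℝ} (hη : 0 < η) :
    ∀ᶠ n : ℕ in Filter.atTop, C + D * Real.log ((n : ℝ) + 1) ≤ n * η := by
  have h1 := Real.isLittleO_log_id_atTop.bound (show 0 < η / (4 * (D + 1)) by positivity)
  have h2 : Filter.Tendsto (fun n : ℕ => (n : ℝ) + 1) Filter.atTop Filter.atTop :=
    Filter.tendsto_atTop_add_const_right _ _ tendsto_natCast_atTop_atTop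
  have h3 := tendsto_natCast_atTop_atTop.eventually_ge_atTop (2 * C / η)
  filter_upwards [h2.eventually h1, h3, Filter.eventually_ge_atTop 1] with n hn hC hn1
  have hn1' : (1 : ℝ) ≤ n := by exact_mod_cast hn1
  have hl : Real.log ((n : ℝ) + 1) ≤ η / (4 * (D + 1)) * (n + 1) := by
    refine (Real.le_norm_self _).trans (hn.trans_eq ?_)
    rw [id, Real.norm_of_nonneg (by positivity)]
  have hDl : D * Real.log ((n : ℝ) + 1) ≤ η / 4 * (n + 1) := by
    have h0 : 0 ≤ Real.log ((n : ℝ) + 1) := Real.log_nonneg (by linarith)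
    calc D * Real.log ((n : ℝ) + 1) ≤ (D + 1) * (η / (4 * (D + 1)) * (n + 1)) :=
          mul_le_mul (by linarith) hl h0 (by linarith)
      _ = _ := by field_simp
  rw [div_le_iff₀ hη] at hC
  nlinarith

/-- Every exponent below `E_x`-objective minus `t E_s` is achieved by constant-composition codes. -/
theorem eventually_exists_code {V X Y : Type*} [Fintype V] [Fintype X] [Fintype Y]
    {PV : V → ℝ} (hPV : IsProbDist PV) {W : X → Y → ℝ} (hW : IsDMC W) {t : ℝ} (ht : 0 < t)
    {ρ : ℝ} (hρ : 1 ≤ ρ) {Q : X → ℝ} (hQ : IsProbDist Q) (a : X → ℝ) {R : ℝ}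
    (hR : R < ExObjective W Q ρ a - t * Es ρ PV) :
    ∀ᶠ n : ℕ in Filter.atTop, ∀ k : ℕ, k = ⌊t * (n : ℝ)⌋₊ →
      ∃ Q' : X → ℝ, IsType n Q' ∧
        ∃ (f : (Fin k → V) → Fin n → X) (φ : (Fin n → Y) → Fin k → V),
          (∀ v, f v ∈ typeClass n Q') ∧ pErr PV W f φ ≤ Real.exp (-(n * R)) := by
  have hρ0 : 0 < ρ := by linarith
  have : Nonempty V := by
    by_contra h
    rw [not_nonempty_iff] at h
    simpa using hPV.2
  set h : X → ℝ := fun x => Real.log (exInner W Q ρ a x) with hh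
  set μ := ∑ x, Q x * h x with hμ
  have hobj : ExObjective W Q ρ a = -ρ * μ := rfl
  set η := ExObjective W Q ρ a - t * Es ρ PV - R with hη
  have hη0 : 0 < η := by linarith
  have hδ : 0 < η / (2 * ρ) := by positivity
  filter_upwards [eventually_exists_type hQ h hδ,
    eventually_add_mul_log_le (Real.log 2 + ρ * Real.log 2) (ρ * Fintype.card X) (by positivity)
      (half_pos hη0)] with n hn hlog k hk
  obtain ⟨x₀, hpos, hmean, hprob⟩ := hn
  set b : ℝ := 1 / (2 * ((n : ℝ) + 1) ^ Fintype.card X) with hb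
  have hb0 : 0 < b := by positivity
  set A : ℝ := b⁻¹ * Real.exp (∑ l, h (x₀ l)) with hA
  have hA0 : 0 < A := mul_pos (inv_pos.2 hb0) (Real.exp_pos _)
  obtain ⟨f, hfT, hf⟩ := exists_code_pairwise_le
    (Finset.univ.filter fun z : Fin n → X => empDist z = empDist x₀) ⟨x₀, by simp⟩
    (fun v : Fin k → V => prodDist PV v) (fun v => prodDist_nonneg hPV v)
    (fun z z' => ∏ l, expNegDB W (z l) (z' l))
    (fun z z' => Finset.prod_nonneg fun l _ => expNegDB_nonneg W _ _)
    (fun z z' => Finset.prod_congr rfl fun l _ => expNegDB_comm W _ _) hρ hA0.le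
    (fun z' hz' => sum_typeClass_rpow_le hW hQ ρ a hpos (Finset.mem_filter.1 hz').2 hb0 hprob)
  obtain ⟨φ, hφ⟩ := exists_decoder_pErr_le PV hPV.1 W hW.1 f
  refine ⟨empDist x₀, ⟨x₀, rfl⟩, f, φ, fun v => (Finset.mem_filter.1 (hfT v)).2, ?_⟩
  refine hφ.trans (hf.trans ?_)
  rw [sum_prodDist_rpow_rpow hPV hρ0.le]
  have hApow : A ^ ρ = Real.exp (ρ * (Real.log 2 + Fintype.card X * Real.log ((n : ℝ) + 1) +
      ∑ l, h (x₀ l))) := by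
    rw [Real.rpow_def_of_pos hA0, hA, Real.log_mul (inv_pos.2 hb0).ne' (Real.exp_pos _).ne',
      Real.log_exp, hb, one_div, inv_inv, Real.log_mul (by norm_num) (by positivity),
      Real.log_pow]
    ring_nf
  have hk' : (k : ℝ) * Es ρ PV ≤ t * n * Es ρ PV := by
    refine mul_le_mul_of_nonneg_right ?_ (Es_nonneg hPV hρ0.le)
    rw [hk]
    exact Nat.floor_le (by positivity)
  have hmean' : ρ * ∑ l, h (x₀ l) ≤ n * (ρ * μ) + n * (η / 2) := by
    have h1 := mul_le_mul_of_nonneg_left hmean hρ0.le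
    have h2 : ρ * (n * (μ + η / (2 * ρ))) = n * (ρ * μ) + n * (η / 2) := by field_simp
    linarith
  have hRn : (n : ℝ) * R = n * (-ρ * μ) - t * n * Es ρ PV - n * η := by
    rw [hη, hobj]; ring
  have hexp : 2 * Real.exp (k * Es ρ PV) * A ^ ρ = Real.exp (Real.log 2 + k * Es ρ PV +
      (ρ * Real.log 2 + ρ * Fintype.card X * Real.log ((n : ℝ) + 1) + ρ * ∑ l, h (x₀ l))) := by
    rw [hApow, Real.exp_add, Real.exp_add, Real.exp_log two_pos]
    congr 2
    ring
  rw [hexp, Real.exp_le_exp, hRn]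
  linarith

theorem exists_pos_le_of_ne_zero {ι : Type*} [Finite ι] (g : ι → ℝ) (hg : ∀ i, 0 ≤ g i) :
    ∃ m, 0 < m ∧ m ≤ 1 ∧ ∀ i, g i ≠ 0 → m ≤ g i := by
  rcases isEmpty_or_nonempty ι with hι | hι
  · exact ⟨1, one_pos, le_rfl, fun i => isEmptyElim i⟩
  · obtain ⟨i₀, hi₀⟩ := Finite.exists_min fun i => if g i = 0 then 1 else min 1 (g i)
    refine ⟨if g i₀ = 0 then 1 else min 1 (g i₀), ?_, ?_, fun i hi => ?_⟩
    · split_ifs with h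
      · exact one_pos
      · exact lt_min one_pos ((hg i₀).lt_of_ne' h)
    · split_ifs
      · exact le_rfl
      · exact min_le_left _ _
    · refine (hi₀ i).trans ?_
      rw [if_neg hi]
      exact min_le_right _ _

/-- An error probability below the least possible positive value of a single error event
vanishes. -/
theorem pErr_eq_zero_of_lt {V X Y : Type*} [Fintype V] [Fintype Y] {PV : V → ℝ}
    (hPV : ∀ v, 0 ≤ PV v) {W : X → Y → ℝ} (hW : ∀ x y, 0 ≤ W x y) {k n : ℕ}
    {f : (Fin k → V) → Fin n → X} {φ : (Fin n → Y) → Fin k → V} {p w : ℝ} (hp : 0 ≤ p)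
    (hw : 0 ≤ w) (hpV : ∀ v, PV v ≠ 0 → p ≤ PV v) (hwW : ∀ x y, W x y ≠ 0 → w ≤ W x y)
    (hlt : pErr PV W f φ < p ^ k * w ^ n) : pErr PV W f φ = 0 := by
  have hP : ∀ v : Fin k → V, 0 ≤ prodDist PV v := fun v => Finset.prod_nonneg fun i _ => hPV _
  have hWn : ∀ (x : Fin n → X) (y : Fin n → Y), 0 ≤ prodChannel W x y :=
    fun x y => Finset.prod_nonneg fun i _ => hW _ _
  have hin : ∀ v, 0 ≤ prodDist PV v * ∑ y ∈ Finset.univ.filter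
      (fun y : Fin n → Y => φ y ≠ v), prodChannel W (f v) y := fun v =>
    mul_nonneg (hP v) (Finset.sum_nonneg fun y _ => hWn _ _)
  refine Finset.sum_eq_zero fun v _ => ?_
  rw [Finset.mul_sum]
  refine Finset.sum_eq_zero fun y hy => ?_
  by_contra hne
  obtain ⟨h1, h2⟩ := mul_ne_zero_iff.1 hne
  have hp1 : p ^ k ≤ prodDist PV v := by
    have := Finset.prod_le_prod (s := Finset.univ) (f := fun _ : Fin k => p)
      (g := fun i => PV (v i)) (fun _ _ => hp)
      fun i hi => hpV _ (Finset.prod_ne_zero_iff.1 h1 i hi)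
    simpa [prodDist] using this
  have hw1 : w ^ n ≤ prodChannel W (f v) y := by
    have := Finset.prod_le_prod (s := Finset.univ) (f := fun _ : Fin n => w)
      (g := fun l => W (f v l) (y l)) (fun _ _ => hw)
      fun l hl => hwW _ _ (Finset.prod_ne_zero_iff.1 h2 l hl)
    simpa [prodChannel] using this
  refine hlt.not_ge ?_
  calc p ^ k * w ^ n ≤ prodDist PV v * prodChannel W (f v) y :=
        mul_le_mul hp1 hw1 (by positivity) (hP v)
    _ ≤ prodDist PV v * ∑ y ∈ Finset.univ.filter
          (fun y : Fin n → Y => φ y ≠ v), prodChannel W (f v) y :=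
        mul_le_mul_of_nonneg_left (Finset.single_le_sum (f := fun y => prodChannel W (f v) y)
          (fun y _ => hWn _ _) hy) (hP v)
    _ ≤ pErr PV W f φ := Finset.single_le_sum (f := fun v => prodDist PV v *
          ∑ y ∈ Finset.univ.filter (fun y : Fin n → Y => φ y ≠ v), prodChannel W (f v) y)
          (fun v _ => hin v) (Finset.mem_univ v)

/-- A real number below the extended exponent is below the objective at some `ρ`, `Q`, `a`. -/
theorem exists_lt_of_lt_EGexDual {V X Y : Type*} [Fintype V] [Fintype X] [Fintype Y]
    {PV : V → ℝ} {W : X → Y → ℝ} {t R : ℝ} (hR : (R : EReal) < EGexDual PV W t) :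
    ∃ ρ : ℝ, 1 ≤ ρ ∧ ∃ Q : X → ℝ, IsProbDist Q ∧ ∃ a : X → ℝ,
      R < ExObjective W Q ρ a - t * Es ρ PV := by
  simp only [EGexDual, lt_iSup_iff] at hR
  obtain ⟨ρ, hρ, hR⟩ := hR
  rw [EReal.lt_sub_iff_add_lt (by simp) (by simp)] at hR
  simp only [ExMax, Ex, lt_iSup_iff] at hR
  obtain ⟨Q, hQ, a, hR⟩ := hR
  refine ⟨ρ, hρ, Q, hQ, a, ?_⟩
  rw [← EReal.coe_add, EReal.coe_lt_coe_iff] at hR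
  linarith

theorem bot_lt_EGexDual {V X Y : Type*} [Fintype V] [Fintype X] [Nonempty X] [Fintype Y]
    (PV : V → ℝ) (W : X → Y → ℝ) (t : ℝ) : ⊥ < EGexDual PV W t := by
  obtain ⟨x⟩ := ‹Nonempty X›
  have hQ : IsProbDist (Pi.single x 1 : X → ℝ) :=
    ⟨fun y => by by_cases h : y = x <;> simp [h], by simp⟩
  have h1 : ((ExObjective W (Pi.single x 1) 1 0 : ℝ) : EReal) ≤ ExMax W 1 :=
    (le_iSup (fun a : X → ℝ => ((ExObjective W (Pi.single x 1) 1 a : ℝ) : EReal)) 0).trans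
      (le_iSup₂ (f := fun (Q : X → ℝ) (_ : IsProbDist Q) => Ex W Q 1) _ hQ)
  have h2 : ((ExObjective W (Pi.single x 1) 1 0 - t * Es 1 PV : ℝ) : EReal) ≤
      EGexDual PV W t := by
    rw [EReal.coe_sub]
    exact (EReal.sub_le_sub h1 le_rfl).trans (le_iSup₂ (f := fun (ρ : ℝ) (_ : 1 ≤ ρ) =>
      (ExMax W ρ - ((t * Es ρ PV : ℝ) : EReal))) 1 le_rfl)
  exact (EReal.bot_lt_coe _).trans_le h2

/-- If the exponent is infinite, zero error probability is attained. -/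
theorem eventually_exists_zero_error_code {V X Y : Type*} [Fintype V] [Fintype X] [Fintype Y]
    {PV : V → ℝ} (hPV : IsProbDist PV) {W : X → Y → ℝ} (hW : IsDMC W) {t : ℝ} (ht : 0 < t)
    (htop : EGexDual PV W t = ⊤) :
    ∀ᶠ n : ℕ in Filter.atTop, ∀ k : ℕ, k = ⌊t * (n : ℝ)⌋₊ →
      ∃ Q' : X → ℝ, IsType n Q' ∧
        ∃ (f : (Fin k → V) → Fin n → X) (φ : (Fin n → Y) → Fin k → V),
          (∀ v, f v ∈ typeClass n Q') ∧ pErr PV W f φ = 0 := by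
  obtain ⟨p, hp0, hp1, hp⟩ := exists_pos_le_of_ne_zero PV hPV.1
  obtain ⟨w, hw0, -, hw⟩ := exists_pos_le_of_ne_zero (fun i : X × Y => W i.1 i.2)
    fun i => hW.1 _ _
  set R := 1 - t * Real.log p - Real.log w with hR
  obtain ⟨ρ, hρ, Q, hQ, a, ha⟩ := exists_lt_of_lt_EGexDual (PV := PV) (W := W) (t := t) (R := R)
    (by rw [htop]; exact EReal.coe_lt_top _)
  filter_upwards [eventually_exists_code hPV hW ht hρ hQ a ha, Filter.eventually_ge_atTop 1]
    with n hn hn1 k hk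
  obtain ⟨Q', hQ', f, φ, hf, hle⟩ := hn k hk
  refine ⟨Q', hQ', f, φ, hf, pErr_eq_zero_of_lt hPV.1 hW.1 hp0.le hw0.le hp
    (fun x y => hw (x, y)) (hle.trans_lt ?_)⟩
  have hn1' : (1 : ℝ) ≤ n := by exact_mod_cast hn1
  have hkt : (k : ℝ) ≤ t * n := by rw [hk]; exact Nat.floor_le (by positivity)
  have hlogp : Real.log p ≤ 0 := Real.log_nonpos hp0.le hp1
  calc Real.exp (-(n * R)) < Real.exp (k * Real.log p + n * Real.log w) := by
        rw [Real.exp_lt_exp, hR]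
        have := mul_le_mul_of_nonpos_right hkt hlogp
        nlinarith
    _ = p ^ k * w ^ n := by
        rw [Real.exp_add, ← Real.log_pow, ← Real.log_pow, Real.exp_log (pow_pos hp0 k),
          Real.exp_log (pow_pos hw0 n)]

end JSCC

end

/-- The exponent `E^dual_{G,ex}(t)` is achievable with constant-composition codes. The bound
`exp(-n(E - ε))` is the extended exponential, so it is `0` when `E = +∞` and `n ≥ 1`. -/
theorem stmt13 {V X Y : Type*} [Fintype V] [Fintype X] [Nonempty X] [Fintype Y]
    (PV : V → ℝ) (hPV : JSCC.IsProbDist PV) (W : X → Y → ℝ) (hW : JSCC.IsDMC W)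
    (t : ℝ) (ht : 0 < t) (ε : ℝ) (hε : 0 < ε) :
    ∃ n₀ : ℕ, ∀ n : ℕ, n₀ ≤ n → ∀ k : ℕ, k = ⌊t * (n : ℝ)⌋₊ →
      ∃ Q : X → ℝ, JSCC.IsType n Q ∧
        ∃ (f : (Fin k → V) → Fin n → X) (φ : (Fin n → Y) → Fin k → V),
          (∀ v, f v ∈ JSCC.typeClass n Q) ∧
          ENNReal.ofReal (JSCC.pErr PV W f φ) ≤
            EReal.exp (-(((n : ℝ) : EReal) * (JSCC.EGexDual PV W t - (ε : EReal)))) := by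
  rw [← Filter.eventually_atTop]
  by_cases htop : JSCC.EGexDual PV W t = ⊤
  · filter_upwards [JSCC.eventually_exists_zero_error_code hPV hW ht htop] with n hn k hk
    obtain ⟨Q, hQ, f, φ, hf, h0⟩ := hn k hk
    exact ⟨Q, hQ, f, φ, hf, by rw [h0, ENNReal.ofReal_zero]; exact zero_le⟩
  · have hE : ((JSCC.EGexDual PV W t).toReal : EReal) = JSCC.EGexDual PV W t :=
      EReal.coe_toReal htop (JSCC.bot_lt_EGexDual PV W t).ne'
    set E := (JSCC.EGexDual PV W t).toReal
    obtain ⟨ρ, hρ, Q₀, hQ₀, a, ha⟩ := JSCC.exists_lt_of_lt_EGexDual (PV := PV) (W := W) (t := t)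
      (R := E - ε) (by rw [← hE, EReal.coe_lt_coe_iff]; linarith)
    filter_upwards [JSCC.eventually_exists_code hPV hW ht hρ hQ₀ a ha] with n hn k hk
    obtain ⟨Q, hQ, f, φ, hf, hle⟩ := hn k hk
    refine ⟨Q, hQ, f, φ, hf, ?_⟩
    rw [← hE, ← EReal.coe_sub, ← EReal.coe_mul, ← EReal.coe_neg, EReal.exp_coe]
    exact ENNReal.ofReal_le_ofReal hle
end
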